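/- arXiv:2006.04447 — 6 statements merged into one kernel-verified Lean document; each statement's English description precedes it below -/
import Mathlib

section
/- Let f : 𝔸 → 𝔸 be a positive twist map with no conjugate points, F a lift of f, and x ∈ ℝ. (i) If Ψ₁(x) < Ψ₋₁(x), then for every y ∈ (Ψ₁(x), Ψ₋₁(x)] the sequence (p₁(Fⁿ(x,y)))_{n≥0} is strictly increasing, for every y ∈ [Ψ₁(x), Ψ₋₁(x)) the sequence (p₁(Fⁿ(x,y)))_{n≤0} is strictly decreasing, the sequence (p₁(Fⁿ(x,Ψ₁(x))))_{n≥1} is strictly increasing, and (p₁(Fⁿ(x,Ψ₋₁(x))))_{n≤−1} is strictly decreasing. (ii) If Ψ₋₁(x) < Ψ₁(x), then for every y ∈ [Ψ₋₁(x), Ψ₁(x)) the sequence (p₁(Fⁿ(x,y)))_{n≥0} is strictly decreasing, for every y ∈ (Ψ₋₁(x), Ψ₁(x)] the sequence (p₁(Fⁿ(x,y)))_{n≤0} is strictly increasing, the sequence (p₁(Fⁿ(x,Ψ₁(x))))_{n≥1} is strictly decreasing, and (p₁(Fⁿ(x,Ψ₋₁(x))))_{n≤−1} is strictly increasing. -/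
noncomputable section

open MeasureTheory Set Filter Topology Function

/-- The annulus `𝔸 = (ℝ/ℤ) × ℝ`. -/
abbrev Ann : Type := AddCircle (1 : ℝ) × ℝ

/-- The plane `ℝ²`, universal cover of the annulus. -/
abbrev Pl : Type := ℝ × ℝ

/-- The covering projection `π : ℝ² → 𝔸`, `π(x,y) = (x + ℤ, y)`. -/
def pr : Pl → Ann := fun p => ((p.1 : AddCircle (1 : ℝ)), p.2)

/-- The vertical vector `v = (0,1)`. -/
def vv : Pl := (0, 1)

/-- Data of a `C¹` diffeomorphism `f` of the annulus, isotopic to the identity,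
presented through a lifted isotopy `(Ft t)_{t ∈ [0,1]}` of `C¹` diffeomorphisms of the
plane commuting with the deck transformation, with `Ft 0 = id` and `Ft 1` a lift of `f`,
whose derivatives depend continuously on `(t, z)`. -/
structure IsotopySetup where
  f : Ann → Ann
  Ft : ℝ → Pl → Pl
  lift_f : ∀ p, pr (Ft 1 p) = f (pr p)
  Ft_zero : Ft 0 = id
  Ft_periodic : ∀ t, ∀ p : Pl, Ft t (p + (1, 0)) = Ft t p + (1, 0)
  Ft_smooth : ∀ t ∈ Icc (0:ℝ) 1, ContDiff ℝ 1 (Ft t)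
  Ft_diffeo : ∀ t ∈ Icc (0:ℝ) 1, ∃ G : Pl → Pl, ContDiff ℝ 1 G ∧
      Function.LeftInverse G (Ft t) ∧ Function.RightInverse G (Ft t)
  Ft_cont : ContinuousOn (fun q : ℝ × Pl => Ft q.1 q.2) (Icc (0:ℝ) 1 ×ˢ univ)
  DFt_cont : ContinuousOn (fun q : ℝ × Pl => fderiv ℝ (Ft q.1) q.2) (Icc (0:ℝ) 1 ×ˢ univ)

namespace IsotopySetup

variable (S : IsotopySetup)

/-- The canonical lift `F : ℝ² → ℝ²` of `f`. -/
def F : Pl → Pl := S.Ft 1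

/-- The extended linearized isotopy: for `t ≥ 0`, `D t p` is the derivative at `p` of the
extended isotopy `f_t`, determined by `Df_{n+s} = Df_s ∘ Df^n` for `n ∈ ℕ`, `s ∈ [0,1)`. -/
def D (t : ℝ) (p : Pl) : Pl →L[ℝ] Pl :=
  (fderiv ℝ (S.Ft (Int.fract t)) (S.F^[⌊t⌋₊] p)).comp (fderiv ℝ (S.F^[⌊t⌋₊]) p)

/-- `S.AngleVar p w n a` : the total angular variation on `[0,n]` of the vector `w ∈ T_{π(p)}𝔸`
under the extended linearized isotopy equals `a`; that is, `a = n·Torsionₙ(f, π(p), w)`.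
Here `Θ` is a continuous lift of the angle `≺(v, Df_t(z)w)` (so that the direction of
`Df_t(z)w` is `(−sin(2πΘ(t)), cos(2πΘ(t)))`). -/
def AngleVar (p w : Pl) (n : ℕ) (a : ℝ) : Prop :=
  ∃ Θ : ℝ → ℝ, ContinuousOn Θ (Icc 0 (n:ℝ)) ∧
    (∀ t ∈ Icc (0:ℝ) (n:ℝ), ∃ r : ℝ, 0 < r ∧
      S.D t p w = r • (-Real.sin (2 * Real.pi * Θ t), Real.cos (2 * Real.pi * Θ t))) ∧
    a = Θ n - Θ 0

/-- `S.TorsionFin p w n τ` : the finite-time torsion `Torsionₙ(f, π(p), w)` equals `τ`. -/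
def TorsionFin (p w : Pl) (n : ℕ) (τ : ℝ) : Prop :=
  ∃ a : ℝ, S.AngleVar p w n a ∧ τ = a / n

/-- The asymptotic torsion at the lifted point `p` exists and equals `L`
(for every choice of nonzero tangent vector `w`). -/
def TorsionLift (p : Pl) (L : ℝ) : Prop :=
  ∀ w : Pl, w ≠ 0 → ∃ a : ℕ → ℝ, (∀ n : ℕ, 1 ≤ n → S.AngleVar p w n (a n)) ∧
    Tendsto (fun n : ℕ => a n / (n : ℝ)) atTop (nhds L)

/-- The asymptotic torsion at `z ∈ 𝔸` exists and equals `L`. -/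
def Torsion (z : Ann) (L : ℝ) : Prop :=
  ∃ p : Pl, pr p = z ∧ S.TorsionLift p L

open Classical in
/-- The asymptotic torsion as a function on the annulus (defaulting to `0` where undefined). -/
def torsionFun (z : Ann) : ℝ :=
  if h : ∃ L, S.Torsion z L then h.choose else 0

/-- The lifted point `p` has conjugate points: `n·Torsionₙ(f,z,v) = −k/2` for some `n,k ≥ 1`. -/
def ConjLift (p : Pl) : Prop :=
  ∃ n k : ℕ, 1 ≤ n ∧ 1 ≤ k ∧ ∃ a : ℝ, S.AngleVar p vv n a ∧ a = -(k : ℝ) / 2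

/-- The lifted point `p` has over-conjugate points: `n·Torsionₙ(f,z,v) < −1/2` for some `n ≥ 1`. -/
def OverConjLift (p : Pl) : Prop :=
  ∃ n : ℕ, 1 ≤ n ∧ ∃ a : ℝ, S.AngleVar p vv n a ∧ a < -(1:ℝ) / 2

/-- The point `z ∈ 𝔸` has conjugate points. -/
def Conj (z : Ann) : Prop := ∃ p : Pl, pr p = z ∧ S.ConjLift p

/-- The point `z ∈ 𝔸` has over-conjugate points. -/
def OverConj (z : Ann) : Prop := ∃ p : Pl, pr p = z ∧ S.OverConjLift p

/-- `f` is a positive twist map: for every `x`, the map `y ↦ p₁(F(x,y))` is an increasing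
diffeomorphism of `ℝ` onto `ℝ`. -/
def PosTwist : Prop :=
  ∀ x : ℝ, StrictMono (fun y => (S.F (x, y)).1) ∧
    Function.Surjective (fun y => (S.F (x, y)).1) ∧
    ∀ y : ℝ, 0 < deriv (fun y => (S.F (x, y)).1) y

/-- `f` has no conjugate points (linearized-dynamics formulation): for every `z ∈ ℝ²` and
`n ≥ 1`, the first component of `DFⁿ(z)(0,1)` does not vanish. -/
def NoConjPts : Prop :=
  ∀ p : Pl, ∀ n : ℕ, 1 ≤ n → ((fderiv ℝ (S.F^[n]) p) (0, 1)).1 ≠ 0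

/-- `f` is exact symplectic: it preserves the Lebesgue measure and `F*(y dx) − y dx = dS`
for a `C¹` function `S : ℝ² → ℝ` with `S(x+1,y) = S(x,y)`. -/
def ExactSymplectic : Prop :=
  MeasurePreserving S.f volume volume ∧
  ∃ Sg : Pl → ℝ, ContDiff ℝ 1 Sg ∧ (∀ p : Pl, Sg (p + (1, 0)) = Sg p) ∧
    ∀ p : Pl,
      fderiv ℝ Sg p (1, 0) = (S.F p).2 * (fderiv ℝ S.F p (1, 0)).1 - p.2 ∧
      fderiv ℝ Sg p (0, 1) = (S.F p).2 * (fderiv ℝ S.F p (0, 1)).1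

end IsotopySetup

/-- `γ` is an essential curve of the annulus: a topological embedding of the circle which is
not homotopic to a constant map. -/
def EssentialCurve (γ : C(AddCircle (1:ℝ), Ann)) : Prop :=
  Topology.IsEmbedding γ ∧ ∀ z : Ann, ¬ γ.Homotopic (ContinuousMap.const _ z)

/-- An open subset of the annulus is essential if it contains an essential curve. -/
def EssentialSet (U : Set Ann) : Prop :=
  ∃ γ : C(AddCircle (1:ℝ), Ann), EssentialCurve γ ∧ range γ ⊆ U

/-- `f` restricted to `U` is `C⁰`-integrable: `U` is the disjoint union of a family of
`f`-invariant images of essential curves. -/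
def C0IntegrableOn (f : Ann → Ann) (U : Set Ann) : Prop :=
  ∃ (ι : Type) (γ : ι → C(AddCircle (1:ℝ), Ann)),
    (∀ i, EssentialCurve (γ i) ∧ f '' range (γ i) = range (γ i)) ∧
    (⋃ i, range (γ i)) = U ∧
    Pairwise (Disjoint on fun i => range (γ i))

/-- `ℤ`-iterates of a bijection (negative iterates through the inverse map). -/
def iterZ {α : Type*} [Nonempty α] (f : α → α) : ℤ → α → α
  | Int.ofNat n => f^[n]
  | Int.negSucc n => (Function.invFun f)^[n + 1]

/-- `ℐ(f)`: the union of all `f`-invariant essential curves. -/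
def invCurveUnion (f : Ann → Ann) : Set Ann :=
  ⋃ γ ∈ {γ : C(AddCircle (1:ℝ), Ann) | EssentialCurve γ ∧ f '' range γ = range γ}, range γ


/-- The determinant of an endomorphism of the plane, in coordinates. -/
def pdet (A : Pl →L[ℝ] Pl) : ℝ :=
  (A (1, 0)).1 * (A (0, 1)).2 - (A (0, 1)).1 * (A (1, 0)).2

lemma clm_expand (A : Pl →L[ℝ] Pl) (w : Pl) :
    A w = w.1 • A (1, 0) + w.2 • A (0, 1) := by
  rw [← map_smul, ← map_smul, ← map_add]
  congr 1
  ext <;> simp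

lemma pdet_comp (A B : Pl →L[ℝ] Pl) : pdet (A.comp B) = pdet A * pdet B := by
  unfold pdet
  simp only [ContinuousLinearMap.comp_apply]
  rw [clm_expand A (B (1, 0)), clm_expand A (B (0, 1))]
  simp only [Prod.fst_add, Prod.snd_add, Prod.smul_fst, Prod.smul_snd, smul_eq_mul]
  ring

lemma pdet_id : pdet (ContinuousLinearMap.id ℝ Pl) = 1 := by
  simp [pdet]

lemma fderiv_inv_comp {F G : Pl → Pl} (hF : ContDiff ℝ 1 F) (hG : ContDiff ℝ 1 G)
    (hl : Function.LeftInverse G F) (p : Pl) :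
    (fderiv ℝ G (F p)).comp (fderiv ℝ F p) = ContinuousLinearMap.id ℝ Pl := by
  have h := fderiv_comp p ((hG.differentiable one_ne_zero) (F p)) ((hF.differentiable one_ne_zero) p)
  rw [← h, hl.comp_eq_id, fderiv_id]

lemma pdet_ne {F G : Pl → Pl} (hF : ContDiff ℝ 1 F) (hG : ContDiff ℝ 1 G)
    (hl : Function.LeftInverse G F) (p : Pl) : pdet (fderiv ℝ F p) ≠ 0 := by
  intro h
  have h1 := congrArg pdet (fderiv_inv_comp hF hG hl p)
  rw [pdet_comp, pdet_id, h, mul_zero] at h1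
  exact zero_ne_one h1

lemma pdet_F_pos (S : IsotopySetup) (p : Pl) : 0 < pdet (fderiv ℝ S.F p) := by
  have hc : ContinuousOn (fun t : ℝ => fderiv ℝ (S.Ft t) p) (Icc (0:ℝ) 1) := by
    have : ContinuousOn (fun t : ℝ => ((t, p) : ℝ × Pl)) (Icc (0:ℝ) 1) := by fun_prop
    exact S.DFt_cont.comp this (fun t ht => ⟨ht, mem_univ _⟩)
  have hd : ContinuousOn (fun t : ℝ => pdet (fderiv ℝ (S.Ft t) p)) (Icc (0:ℝ) 1) := by
    unfold pdet
    have h1 := hc.clm_apply (continuousOn_const (c := ((1, 0) : Pl)))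
    have h2 := hc.clm_apply (continuousOn_const (c := ((0, 1) : Pl)))
    exact (h1.fst.mul h2.snd).sub (h2.fst.mul h1.snd)
  have h0 : pdet (fderiv ℝ (S.Ft 0) p) = 1 := by
    rw [S.Ft_zero, fderiv_id, pdet_id]
  by_contra hneg
  have hneg : pdet (fderiv ℝ (S.Ft 1) p) ≤ 0 := not_lt.mp hneg
  have := intermediate_value_Icc' zero_le_one hd
  obtain ⟨t, ht, h⟩ := this ⟨hneg, by simp [h0]⟩
  obtain ⟨G, hG, hl, -⟩ := S.Ft_diffeo t ht
  exact pdet_ne (S.Ft_smooth t ht) hG hl p h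

lemma contDiff_iter {H : Pl → Pl} (hH : ContDiff ℝ 1 H) (n : ℕ) : ContDiff ℝ 1 (H^[n]) := by
  induction n with
  | zero => exact contDiff_id
  | succ n ih => rw [iterate_succ]; exact ih.comp hH

lemma pdet_iter_pos (S : IsotopySetup) (hF : ContDiff ℝ 1 S.F) (n : ℕ) (p : Pl) :
    0 < pdet (fderiv ℝ (S.F^[n]) p) := by
  induction n generalizing p with
  | zero => rw [iterate_zero, fderiv_id, pdet_id]; exact one_pos
  | succ n ih =>
    rw [iterate_succ, fderiv_comp p (((contDiff_iter hF n).differentiable one_ne_zero) _)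
      ((hF.differentiable one_ne_zero) p), pdet_comp]
    exact mul_pos (ih _) (pdet_F_pos S p)

lemma hasDerivAt_vert {H : Pl → Pl} (hH : ContDiff ℝ 1 H) (x y : ℝ) :
    HasDerivAt (fun y => (H (x, y)).1) (fderiv ℝ H (x, y) (0, 1)).1 y := by
  have h1 : HasDerivAt (fun y : ℝ => ((x, y) : Pl)) (0, 1) y :=
    (hasDerivAt_const y x).prodMk (hasDerivAt_id y)
  have h2 := ((hH.differentiable one_ne_zero) (x, y)).hasFDerivAt.comp_hasDerivAt y h1
  exact h2.fst

/-- If `H` preserves orientation and twists positively then its inverse twists negatively. -/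
lemma strictAnti_inv {H K : Pl → Pl} (hH : ContDiff ℝ 1 H) (hK : ContDiff ℝ 1 K)
    (hl : Function.LeftInverse K H) (hr : Function.RightInverse K H)
    (hdet : ∀ p, 0 < pdet (fderiv ℝ H p))
    (hpos : ∀ p, 0 < (fderiv ℝ H p (0, 1)).1) (x : ℝ) :
    StrictAnti (fun y => (K (x, y)).1) := by
  apply strictAnti_of_deriv_neg
  intro y
  rw [(hasDerivAt_vert hK x y).deriv]
  have h := fderiv_inv_comp hK hH hr (x, y)
  have h2 := DFunLike.congr_fun h ((0, 1) : Pl)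
  simp only [ContinuousLinearMap.comp_apply, ContinuousLinearMap.id_apply] at h2
  have hd := hdet (K (x, y))
  have hp := hpos (K (x, y))
  set A := fderiv ℝ H (K (x, y))
  set w := fderiv ℝ K (x, y) (0, 1)
  rw [clm_expand A w] at h2
  have e1 := congrArg Prod.fst h2
  have e2 := congrArg Prod.snd h2
  simp only [Prod.fst_add, Prod.snd_add, Prod.smul_fst, Prod.smul_snd, smul_eq_mul] at e1 e2
  have key : w.1 * pdet A = - (A (0, 1)).1 := by
    unfold pdet
    linear_combination (A (0, 1)).2 * e1 - (A (0, 1)).1 * e2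
  by_contra hcon
  have := mul_nonneg (not_lt.mp hcon) hd.le
  linarith

lemma iter_periodic (S : IsotopySetup) (n : ℕ) (p : Pl) :
    S.F^[n] (p + (1, 0)) = S.F^[n] p + (1, 0) := by
  induction n generalizing p with
  | zero => rfl
  | succ n ih =>
    rw [iterate_succ_apply, iterate_succ_apply]
    have : S.F (p + (1, 0)) = S.F p + (1, 0) := S.Ft_periodic 1 p
    rw [this, ih]

lemma forward_pos (S : IsotopySetup) (htwist : S.PosTwist) (hnc : S.NoConjPts)
    (hF : ContDiff ℝ 1 S.F) {G : Pl → Pl} (hl : Function.LeftInverse G S.F)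
    (hGanti : ∀ x, StrictAnti (fun y => (G (x, y)).1)) (n : ℕ) :
    ∀ x, StrictMono (fun y => (S.F^[n + 1] (x, y)).1) := by
  induction n with
  | zero => intro x; exact (htwist x).1
  | succ n ih =>
    intro x
    have hH := contDiff_iter hF (n + 1 + 1)
    have hper : ∀ y, (S.F^[n + 1 + 1] (x + 1, y)).1 = (S.F^[n + 1 + 1] (x, y)).1 + 1 := by
      intro y
      have := iter_periodic S (n + 1 + 1) (x, y)
      simp only [Prod.mk_add_mk, add_zero] at this
      rw [this]; rfl
    have hdich := hasDerivWithinAt_forall_lt_or_forall_gt_of_forall_ne (s := univ)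
      (f := fun y => (S.F^[n + 1 + 1] (x, y)).1)
      (f' := fun y => (fderiv ℝ (S.F^[n + 1 + 1]) (x, y) (0, 1)).1) (m := 0)
      convex_univ (fun y _ => (hasDerivAt_vert hH x y).hasDerivWithinAt)
      (fun y _ => hnc (x, y) (n + 1 + 1) (by omega))
    rcases hdich with hneg | hpos
    · exfalso
      have hanti : StrictAnti (fun y => (S.F^[n + 1 + 1] (x, y)).1) := by
        apply strictAnti_of_deriv_neg
        intro y
        rw [(hasDerivAt_vert hH x y).deriv]
        exact hneg y (mem_univ _)
      obtain ⟨y', hy'⟩ := (htwist (x + 1)).2.1 (S.F (x, 0)).1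
      simp only at hy'
      have hF1 : S.F (x + 1, 0) = S.F (x, 0) + (1, 0) := by
        have := iter_periodic S 1 (x, 0)
        simpa using this
      have hlt : y' < 0 := by
        apply (htwist (x + 1)).1.lt_iff_lt.mp
        simp only [hy', hF1, Prod.fst_add]
        linarith
      have h1 := hanti hlt
      simp only at h1
      have h2 : (S.F (x + 1, y')).2 < (S.F (x, 0)).2 := by
        apply (hGanti (S.F (x, 0)).1).lt_iff_gt.mp
        have e1 : (G ((S.F (x, 0)).1, (S.F (x, 0)).2)).1 = x := by
          rw [Prod.mk.eta, hl]
        have e2 : (G ((S.F (x, 0)).1, (S.F (x + 1, y')).2)).1 = x + 1 := by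
          rw [← hy', Prod.mk.eta, hl]
        show (G ((S.F (x, 0)).1, (S.F (x, 0)).2)).1 < (G ((S.F (x, 0)).1, (S.F (x + 1, y')).2)).1
        rw [e1, e2]
        linarith
      have h3 := ih (S.F (x, 0)).1 h2
      simp only at h3
      nth_rewrite 1 [← hy'] at h3
      rw [Prod.mk.eta, Prod.mk.eta, ← iterate_succ_apply, ← iterate_succ_apply] at h3
      rw [hper y'] at h3
      linarith
    · apply strictMono_of_deriv_pos
      intro y
      rw [(hasDerivAt_vert hH x y).deriv]
      exact hpos y (mem_univ _)

/-- Monotonicity of the sequences `(p₁(Fⁿ(x,y)))` for points between the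
graphs of `Ψ₁` and `Ψm`. A sequence indexed by `n ≤ 0` is encoded through `m ↦ F⁻ᵐ`,
`m ∈ ℕ` (so "strictly decreasing in `n ≤ 0`" becomes "strictly increasing in `m`"). -/
theorem statement10 (S : IsotopySetup) (htwist : S.PosTwist) (hnc : S.NoConjPts)
    (Ψ₁ Ψm : ℝ → ℝ) (hΨ₁C : ContDiff ℝ 1 Ψ₁) (hΨmC : ContDiff ℝ 1 Ψm)
    (hΨ₁per : ∀ x : ℝ, Ψ₁ (x + 1) = Ψ₁ x) (hΨmper : ∀ x : ℝ, Ψm (x + 1) = Ψm x)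
    (hΨ₁ : ∀ p : Pl, (S.F p).1 = p.1 ↔ p.2 = Ψ₁ p.1)
    (hΨm : ∀ p : Pl, (Function.invFun S.F p).1 = p.1 ↔ p.2 = Ψm p.1)
    (x : ℝ) :
    (Ψ₁ x < Ψm x →
      (∀ y ∈ Ioc (Ψ₁ x) (Ψm x), StrictMono (fun n : ℕ => (S.F^[n] (x, y)).1)) ∧
      (∀ y ∈ Ico (Ψ₁ x) (Ψm x),
        StrictMono (fun m : ℕ => ((Function.invFun S.F)^[m] (x, y)).1)) ∧
      StrictMono (fun n : ℕ => (S.F^[n + 1] (x, Ψ₁ x)).1) ∧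
      StrictMono (fun m : ℕ => ((Function.invFun S.F)^[m + 1] (x, Ψm x)).1)) ∧
    (Ψm x < Ψ₁ x →
      (∀ y ∈ Ico (Ψm x) (Ψ₁ x), StrictAnti (fun n : ℕ => (S.F^[n] (x, y)).1)) ∧
      (∀ y ∈ Ioc (Ψm x) (Ψ₁ x),
        StrictAnti (fun m : ℕ => ((Function.invFun S.F)^[m] (x, y)).1)) ∧
      StrictAnti (fun n : ℕ => (S.F^[n + 1] (x, Ψ₁ x)).1) ∧
      StrictAnti (fun m : ℕ => ((Function.invFun S.F)^[m + 1] (x, Ψm x)).1)) := by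
  have h11 : (1:ℝ) ∈ Icc (0:ℝ) 1 := ⟨zero_le_one, le_rfl⟩
  have hF : ContDiff ℝ 1 S.F := S.Ft_smooth 1 h11
  obtain ⟨G, hG, hl, hr⟩ := S.Ft_diffeo 1 h11
  change Function.LeftInverse G S.F at hl
  change Function.RightInverse G S.F at hr
  have hinv : Function.invFun S.F = G := Function.invFun_eq_of_injective_of_rightInverse hl.injective hr
  rw [hinv] at hΨm ⊢
  have hG1 : ∀ x, StrictAnti (fun y => (G (x, y)).1) := by
    refine strictAnti_inv hF hG hl hr (pdet_F_pos S) ?_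
    rintro ⟨u, v⟩
    have := (htwist u).2.2 v
    rwa [(hasDerivAt_vert hF u v).deriv] at this
  have hmono := forward_pos S htwist hnc hF hl hG1
  have hanti : ∀ n x, StrictAnti (fun y => (G^[n + 1] (x, y)).1) := by
    intro n
    refine strictAnti_inv (contDiff_iter hF (n + 1)) (contDiff_iter hG (n + 1)) (hl.iterate _) (hr.iterate _)
      (pdet_iter_pos S hF _) ?_
    rintro ⟨u, v⟩
    refine lt_of_le_of_ne ?_ (hnc (u, v) (n + 1) (by omega)).symm
    rw [← (hasDerivAt_vert (contDiff_iter hF (n + 1)) u v).deriv]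
    exact (hmono n u).monotone.deriv_nonneg
  have hmono' : ∀ n x, Monotone (fun y => (S.F^[n] (x, y)).1) := by
    rintro (_ | n) x
    · intro a b _; exact le_rfl
    · exact (hmono n x).monotone
  have hanti' : ∀ n x, Antitone (fun y => (G^[n] (x, y)).1) := by
    rintro (_ | n) x
    · intro a b _; exact le_rfl
    · exact (hanti n x).antitone
  have hFx : S.F (x, Ψ₁ x) = (x, Ψm x) := by
    have h1 : (S.F (x, Ψ₁ x)).1 = x := (hΨ₁ (x, Ψ₁ x)).mpr rfl
    have h2 : (S.F (x, Ψ₁ x)).2 = Ψm (S.F (x, Ψ₁ x)).1 := by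
      apply (hΨm _).mp
      rw [hl, h1]
    rw [h1] at h2
    exact Prod.ext h1 h2
  have hGx : G (x, Ψm x) = (x, Ψ₁ x) := by rw [← hFx, hl]
  have eF : ∀ n, S.F^[n + 1] (x, Ψ₁ x) = S.F^[n] (x, Ψm x) := fun n => by
    rw [iterate_succ_apply, hFx]
  have eG : ∀ n, G^[n + 1] (x, Ψm x) = G^[n] (x, Ψ₁ x) := fun n => by
    rw [iterate_succ_apply, hGx]
  simp only [eF, eG]
  constructor
  · intro hlt
    have A : ∀ y ∈ Ioc (Ψ₁ x) (Ψm x), StrictMono (fun n : ℕ => (S.F^[n] (x, y)).1) := by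
      intro y hy
      refine strictMono_nat_of_lt_succ fun n => ?_
      have h1 := hmono' n x hy.2
      have h2 := hmono n x hy.1
      simp only [eF] at h1 h2
      exact h1.trans_lt h2
    have B : ∀ y ∈ Ico (Ψ₁ x) (Ψm x), StrictMono (fun n : ℕ => (G^[n] (x, y)).1) := by
      intro y hy
      refine strictMono_nat_of_lt_succ fun n => ?_
      have h1 := hanti' n x hy.1
      have h2 := hanti n x hy.2
      simp only [eG] at h1 h2
      exact h1.trans_lt h2
    exact ⟨A, B, A _ ⟨hlt, le_rfl⟩, B _ ⟨le_rfl, hlt⟩⟩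
  · intro hlt
    have A : ∀ y ∈ Ico (Ψm x) (Ψ₁ x), StrictAnti (fun n : ℕ => (S.F^[n] (x, y)).1) := by
      intro y hy
      refine strictAnti_nat_of_succ_lt fun n => ?_
      have h1 := hmono' n x hy.1
      have h2 := hmono n x hy.2
      simp only [eF] at h1 h2
      exact h2.trans_le h1
    have B : ∀ y ∈ Ioc (Ψm x) (Ψ₁ x), StrictAnti (fun n : ℕ => (G^[n] (x, y)).1) := by
      intro y hy
      refine strictAnti_nat_of_succ_lt fun n => ?_
      have h1 := hanti' n x hy.2
      have h2 := hanti n x hy.1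
      simp only [eG] at h1 h2
      exact h2.trans_le h1
    exact ⟨A, B, A _ ⟨le_rfl, hlt⟩, B _ ⟨hlt, le_rfl⟩⟩

end
end

section
/- Let f : 𝔸 → 𝔸 be a positive twist map with no conjugate points and F a lift of f. Let x₁ < x₂ be such that Ψ₁(x₁) < Ψ₋₁(x₁) and Ψ₋₁(x₂) < Ψ₁(x₂). Then at least one of the following holds: (a) for every y ∈ [Ψ₁(x₁), Ψ₋₁(x₁)] and every n ∈ ℕ, p₁(Fⁿ(x₁,y)) < x₂; or (b) for every y ∈ [Ψ₋₁(x₂), Ψ₁(x₂)] and every n ∈ ℕ, p₁(F⁻ⁿ(x₂,y)) > x₁. -/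
noncomputable section

open MeasureTheory Set Filter Topology Function

namespace TwistAux

/-- A continuous injective function which is large at arbitrarily far nonnegative points
and small at nonpositive points is an increasing bijection. -/
lemma mono_surj_of_seq {φ : ℝ → ℝ} (hc : Continuous φ) (hi : Injective φ) (a c : ℝ)
    (hp : ∀ j : ℕ, ∃ y, a ≤ y ∧ c + j ≤ φ y) (hm : ∀ j : ℕ, ∃ y, y ≤ a ∧ φ y ≤ c - j) :
    StrictMono φ ∧ Surjective φ := by
  constructor
  · rcases hc.strictMono_of_inj hi with h | h
    · exact h
    · exfalso
      obtain ⟨j, hj⟩ := exists_nat_gt (φ a - c)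
      obtain ⟨y, hy, hy'⟩ := hp j
      have := h.antitone hy
      linarith
  · intro b
    obtain ⟨j, hj⟩ := exists_nat_gt (b - c)
    obtain ⟨k, hk⟩ := exists_nat_gt (c - b)
    obtain ⟨y, -, hy⟩ := hp j
    obtain ⟨y', -, hy'⟩ := hm k
    exact mem_range_of_exists_le_of_exists_ge hc ⟨y', by linarith⟩ ⟨y, by linarith⟩

lemma anti_of_seq {φ : ℝ → ℝ} (hc : Continuous φ) (hi : Injective φ) (a c : ℝ)
    (hp : ∀ j : ℕ, ∃ y, a ≤ y ∧ φ y ≤ c - j) : StrictAnti φ := by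
  rcases hc.strictMono_of_inj hi with h | h
  · exfalso
    obtain ⟨j, hj⟩ := exists_nat_gt (c - φ a)
    obtain ⟨y, hy, hy'⟩ := hp j
    have := h.monotone hy
    linarith
  · exact h

lemma shift_nat {F : Pl → Pl} (hF : ∀ p : Pl, F (p + (1, 0)) = F p + (1, 0)) (j : ℕ) (p : Pl) :
    F (p + ((j : ℝ), 0)) = F p + ((j : ℝ), 0) := by
  induction j with
  | zero => simp [← Prod.zero_eq_mk]
  | succ k ih =>
    have e : (((k + 1 : ℕ) : ℝ), (0 : ℝ)) = ((k : ℝ), (0 : ℝ)) + (1, 0) := by simp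
    rw [e, ← add_assoc, hF, ih, add_assoc]

lemma shift_iter {F : Pl → Pl} (hF : ∀ p : Pl, F (p + (1, 0)) = F p + (1, 0)) (n : ℕ) (p : Pl) :
    F^[n] (p + (1, 0)) = F^[n] p + (1, 0) := by
  induction n generalizing p with
  | zero => rfl
  | succ k ih => rw [iterate_succ_apply, iterate_succ_apply, hF, ih]

/-- iterates are twist maps, and their inverses are negative twist. -/
def Tw (F G : Pl → Pl) (n : ℕ) : Prop :=
  (∀ x, StrictMono (fun y => (F^[n] (x, y)).1) ∧ Surjective (fun y => (F^[n] (x, y)).1)) ∧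
  ∀ X, StrictAnti (fun Y => (G^[n] (X, Y)).1)

section
variable {F G : Pl → Pl}

lemma tw_step (hFc : Continuous F) (hGc : Continuous G)
    (hGF : LeftInverse G F) (hFG : RightInverse G F)
    (hFs : ∀ p : Pl, F (p + (1, 0)) = F p + (1, 0))
    (hGs : ∀ p : Pl, G (p + (1, 0)) = G p + (1, 0))
    (hinj : ∀ n, 1 ≤ n → ∀ x, Injective (fun y => (F^[n] (x, y)).1))
    (h1 : Tw F G 1) (n : ℕ) (hn : Tw F G n) : Tw F G (n + 1) := by
  obtain ⟨hA, hB⟩ := hn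
  have hA1 : ∀ x, StrictMono (fun y => (F (x, y)).1) := fun x => (h1.1 x).1
  have hB1 : ∀ x, StrictAnti (fun y => (G (x, y)).1) := fun x => h1.2 x
  have hGFn := hGF.iterate n
  have hFGn := hFG.iterate n
  -- the basic sequence
  have key : ∀ x y₀ : ℝ, ∀ j : ℕ, ∃ y Y, y₀ ≤ y ∧ (F^[n] (x, y₀)).2 ≤ Y ∧
      F^[n] (x, y) = ((F^[n] (x, y₀)).1 + j, Y) ∧
      G^[n] ((F^[n] (x, y₀)).1, Y) = (x - j, y) := by
    intro x y₀ j
    obtain ⟨y, hy⟩ := (hA x).2 ((F^[n] (x, y₀)).1 + j)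
    have hj : (0 : ℝ) ≤ j := Nat.cast_nonneg j
    have e1 : F^[n] (x, y) = ((F^[n] (x, y₀)).1 + j, (F^[n] (x, y)).2) := Prod.ext hy rfl
    have e2 : G^[n] ((F^[n] (x, y₀)).1, (F^[n] (x, y)).2) = (x - j, y) := by
      have := shift_nat (shift_iter hGs n) j ((F^[n] (x, y₀)).1, (F^[n] (x, y)).2)
      rw [Prod.mk_add_mk, add_zero, ← e1, hGFn] at this
      have h1 := congrArg Prod.fst this
      have h2 := congrArg Prod.snd this
      simp at h1 h2
      ext
      · simp; linarith
      · simp [← h2]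
    refine ⟨y, _, ?_, ?_, e1, e2⟩
    · apply (hA x).1.le_iff_le.1
      simp only at hy ⊢
      linarith
    · apply (hB (F^[n] (x, y₀)).1).le_iff_ge.1
      simp only [e2]
      have : G^[n] ((F^[n] (x, y₀)).1, (F^[n] (x, y₀)).2) = (x, y₀) := hGFn _
      rw [this]
      simp
  have keym : ∀ x y₀ : ℝ, ∀ j : ℕ, ∃ y Y, y ≤ y₀ ∧ Y ≤ (F^[n] (x, y₀)).2 ∧
      F^[n] (x, y) = ((F^[n] (x, y₀)).1 - j, Y) := by
    intro x y₀ j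
    obtain ⟨y, hy⟩ := (hA x).2 ((F^[n] (x, y₀)).1 - j)
    have hj : (0 : ℝ) ≤ j := Nat.cast_nonneg j
    have e1 : F^[n] (x, y) = ((F^[n] (x, y₀)).1 - j, (F^[n] (x, y)).2) := Prod.ext hy rfl
    have e2 : G^[n] ((F^[n] (x, y₀)).1, (F^[n] (x, y)).2) = (x + j, y) := by
      have := shift_nat (shift_iter hGs n) j (F^[n] (x, y))
      rw [hGFn] at this
      rw [e1, Prod.mk_add_mk, add_zero, sub_add_cancel] at this
      simpa using this
    refine ⟨y, _, ?_, ?_, e1⟩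
    · apply (hA x).1.le_iff_le.1
      simp only at hy ⊢
      linarith
    · apply (hB (F^[n] (x, y₀)).1).le_iff_ge.1
      simp only [e2]
      have : G^[n] ((F^[n] (x, y₀)).1, (F^[n] (x, y₀)).2) = (x, y₀) := hGFn _
      rw [this]
      simp
  have hA' : ∀ x, StrictMono (fun y => (F^[n+1] (x, y)).1) ∧
      Surjective (fun y => (F^[n+1] (x, y)).1) := by
    intro x
    refine mono_surj_of_seq ?_ (hinj (n+1) (by omega) x) 0 (F (F^[n] (x, 0))).1 ?_ ?_
    · have := hFc.iterate (n+1)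
      fun_prop
    · intro j
      obtain ⟨y, Y, h0, h1, h2, -⟩ := key x 0 j
      refine ⟨y, h0, ?_⟩
      rw [iterate_succ_apply', h2]
      have := shift_nat hFs j ((F^[n] (x, 0)).1, Y)
      rw [Prod.mk_add_mk, add_zero] at this
      rw [this]
      have := (hA1 (F^[n] (x, 0)).1).monotone h1
      simp at this ⊢
      exact this
    · intro j
      obtain ⟨y, Y, h0, h1, h2⟩ := keym x 0 j
      refine ⟨y, h0, ?_⟩
      rw [iterate_succ_apply', h2]
      have := shift_nat hFs j ((F^[n] (x, 0)).1 - j, Y)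
      rw [Prod.mk_add_mk, add_zero, sub_add_cancel] at this
      have h3 := congrArg Prod.fst this
      have := (hA1 (F^[n] (x, 0)).1).monotone h1
      simp at this h3 ⊢
      linarith
  refine ⟨hA', ?_⟩
  intro X
  have hGFn1 := hGF.iterate (n+1)
  have hFGn1 := hFG.iterate (n+1)
  refine anti_of_seq ?_ ?_ 0 (G (G^[n] (X, 0))).1 ?_
  · have := hGc.iterate (n+1)
    fun_prop
  · intro Y Y' h
    simp only at h
    have e1 : F^[n+1] (G^[n+1] (X, Y)) = (X, Y) := hFGn1 _
    have e2 : F^[n+1] (G^[n+1] (X, Y')) = (X, Y') := hFGn1 _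
    have h2 : (G^[n+1] (X, Y)).2 = (G^[n+1] (X, Y')).2 := by
      apply (hA' (G^[n+1] (X, Y)).1).1.injective
      simp only
      rw [Prod.mk.eta, e1, h, Prod.mk.eta, e2]
    have h3 := Prod.ext h h2
    have := e1.symm.trans ((congrArg _ h3).trans e2)
    exact congrArg Prod.snd this
  · intro j
    have e : F^[n] ((G^[n] (X, 0)).1, (G^[n] (X, 0)).2) = (X, 0) := hFGn _
    obtain ⟨y, Y, h0, h1, -, h3⟩ := key (G^[n] (X, 0)).1 (G^[n] (X, 0)).2 j
    rw [e] at h1 h3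
    refine ⟨Y, h1, ?_⟩
    simp only at h3
    rw [iterate_succ_apply', h3]
    have := shift_nat hGs j ((G^[n] (X, 0)).1 - j, y)
    rw [Prod.mk_add_mk, add_zero, sub_add_cancel] at this
    have h4 := congrArg Prod.fst this
    have := (hB1 (G^[n] (X, 0)).1).antitone h0
    simp at this h4 ⊢
    linarith

lemma crossing (hGF : LeftInverse G F) (h : ∀ n, 1 ≤ n → Tw F G n) (z w : Pl) (k : ℕ)
    (hk : 1 ≤ k) (h0 : z.1 ≤ w.1) (h1 : (F^[k] w).1 ≤ (F^[k] z).1) :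
    (F^[k+1] w).1 ≤ (F^[k+1] z).1 ∧
    ((z.1 < w.1 ∨ (F^[k] w).1 < (F^[k] z).1) → (F^[k+1] w).1 < (F^[k+1] z).1) := by
  obtain ⟨y', hy'⟩ := ((h k hk).1 w.1).2 (F^[k] z).1
  simp only at hy'
  have hGFk := hGF.iterate k
  have eP : F^[k] (w.1, y') = ((F^[k] z).1, (F^[k] (w.1, y')).2) := Prod.ext hy' rfl
  have gP : G^[k] ((F^[k] z).1, (F^[k] (w.1, y')).2) = (w.1, y') := by rw [← eP]; exact hGFk _
  have gZ : G^[k] ((F^[k] z).1, (F^[k] z).2) = z := hGFk _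
  have hB := (h k hk).2 (F^[k] z).1
  have hF := ((h 1 le_rfl).1 (F^[k] z).1).1
  have hAk := ((h k hk).1 w.1).1
  have hAk1 := ((h (k+1) (by omega)).1 w.1).1
  have s1 : (F^[k] (w.1, y')).2 ≤ (F^[k] z).2 := by
    apply hB.le_iff_ge.1; simp only [gP, gZ]; exact h0
  have s1' : z.1 < w.1 → (F^[k] (w.1, y')).2 < (F^[k] z).2 := by
    intro hl; apply hB.lt_iff_gt.1; simp only [gP, gZ]; exact hl
  have s2 : w.2 ≤ y' := by
    apply hAk.le_iff_le.1; simp only [hy']; exact h1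
  have s2' : (F^[k] w).1 < (F^[k] z).1 → w.2 < y' := by
    intro hl; apply hAk.lt_iff_lt.1; simp only [hy']; exact hl
  have t1 := hF.monotone s1
  have t1' := fun q => hF (s1' q)
  have t2 := hAk1.monotone s2
  have t2' := fun q => hAk1 (s2' q)
  simp only [iterate_one] at t1 t1'
  rw [← eP] at t1 t1'
  simp only [Prod.mk.eta, ← iterate_succ_apply' F] at t1 t1' t2 t2'
  refine ⟨t2.trans t1, ?_⟩
  rintro (q | q)
  · exact t2.trans_lt (t1' q)
  · exact (t2' q).trans_le t1

lemma crossing_le (hGF : LeftInverse G F) (h : ∀ n, 1 ≤ n → Tw F G n) (z w : Pl) (k : ℕ)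
    (hk : 1 ≤ k) (h0 : z.1 ≤ w.1) (h1 : (F^[k] w).1 ≤ (F^[k] z).1) (j : ℕ) :
    (F^[k+j] w).1 ≤ (F^[k+j] z).1 := by
  induction j with
  | zero => exact h1
  | succ j ih => exact (crossing hGF h z w (k+j) (by omega) h0 ih).1

lemma crossing_lt (hGF : LeftInverse G F) (h : ∀ n, 1 ≤ n → Tw F G n) (z w : Pl) (k : ℕ)
    (hk : 1 ≤ k) (h0 : z.1 ≤ w.1) (h1 : (F^[k] w).1 < (F^[k] z).1) (j : ℕ) :
    (F^[k+j] w).1 < (F^[k+j] z).1 := by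
  induction j with
  | zero => exact h1
  | succ j ih => exact (crossing hGF h z w (k+j) (by omega) h0 ih.le).2 (Or.inr ih)

/-- an orbit with a local minimum at time `0` decreases in the past. -/
lemma past (hGF : LeftInverse G F) (hFG : RightInverse G F) (h : ∀ n, 1 ≤ n → Tw F G n) (z : Pl)
    (h1 : z.1 ≤ (F z).1) (h2 : z.1 ≤ (G z).1) (k : ℕ) : z.1 ≤ (G^[k] z).1 := by
  have step : ∀ k, (G^[k] z).1 ≤ (G^[k+1] z).1 := by
    intro k
    rcases Nat.eq_zero_or_pos k with rfl | hk
    · exact h2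
    by_contra! hlt
    have e1 : F^[k] (G^[k+1] z) = G z := by
      rw [iterate_succ_apply]; exact hFG.iterate k _
    have e2 : F^[k] (G^[k] z) = z := hFG.iterate k _
    have := (crossing hGF h (G^[k+1] z) (G^[k] z) k hk hlt.le (by rw [e1, e2]; exact h2)).2
      (Or.inl hlt)
    rw [iterate_succ_apply', iterate_succ_apply', e1, e2, hFG z] at this
    linarith
  induction k with
  | zero => exact le_rfl
  | succ k ih => exact ih.trans (step k)

/-- an orbit with a local maximum at time `0` decreases in the future. -/
lemma future (hGF : LeftInverse G F) (hFG : RightInverse G F) (h : ∀ n, 1 ≤ n → Tw F G n) (z : Pl)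
    (h1 : (F z).1 ≤ z.1) (h2 : (G z).1 ≤ z.1) (k : ℕ) : (F^[k] z).1 ≤ z.1 := by
  have step : ∀ k, (F^[k+1] z).1 ≤ (F^[k] z).1 := by
    intro k
    have := crossing_le hGF h (G z) z 1 le_rfl h2 (by simpa [hFG z] using h1) k
    rw [add_comm 1 k, iterate_succ_apply F k (G z), hFG z] at this
    exact this
  induction k with
  | zero => exact le_rfl
  | succ k ih => exact (step k).trans ih

lemma core (hGF : LeftInverse G F) (hFG : RightInverse G F) (h : ∀ n, 1 ≤ n → Tw F G n)
    (a b : Pl) (hab : a.1 < b.1)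
    (ha1 : a.1 ≤ (F a).1) (ha2 : a.1 ≤ (G a).1) (hb1 : (F b).1 ≤ b.1) (hb2 : (G b).1 ≤ b.1)
    (n m : ℕ) (hn : b.1 ≤ (F^[n] a).1) (hm : (G^[m] b).1 ≤ a.1) : False := by
  have hm0 : 1 ≤ m := by
    rcases Nat.eq_zero_or_pos m with rfl | hk
    · simp at hm; linarith
    · exact hk
  have p := past hGF hFG h a ha1 ha2 m
  have f := future hGF hFG h b hb1 hb2 n
  have ea : F^[m] (G^[m] a) = a := hFG.iterate m _
  have eb : F^[m] (G^[m] b) = b := hFG.iterate m _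
  have := crossing_lt hGF h (G^[m] b) (G^[m] a) m hm0 (hm.trans p) (by rw [ea, eb]; exact hab) n
  rw [add_comm m n, iterate_add_apply, iterate_add_apply, ea, eb] at this
  linarith

end

/-- the two-dimensional determinant -/
def dt (A : Pl →L[ℝ] Pl) : ℝ := (A (1, 0)).1 * (A (0, 1)).2 - (A (1, 0)).2 * (A (0, 1)).1

lemma clm_apply (A : Pl →L[ℝ] Pl) (u : Pl) : A u = u.1 • A (1, 0) + u.2 • A (0, 1) := by
  rw [← map_smul, ← map_smul, ← map_add]; simp

lemma inv_fderiv {F G : Pl → Pl} (hF : ContDiff ℝ 1 F) (hG : ContDiff ℝ 1 G)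
    (hGF : LeftInverse G F) (hFG : RightInverse G F) (p u : Pl) :
    fderiv ℝ F p (fderiv ℝ G (F p) u) = u := by
  have hF' : HasFDerivAt F (fderiv ℝ F p) (G (F p)) := by
    rw [hGF p]; exact (hF.differentiable one_ne_zero p).hasFDerivAt
  have hG' := (hG.differentiable one_ne_zero (F p)).hasFDerivAt
  have h := hF'.comp (F p) hG'
  have e : F ∘ G = id := funext hFG
  rw [e] at h
  have := h.unique (hasFDerivAt_id (F p))
  simpa using congrArg (fun L => L u) this

lemma dt_ne {A B : Pl →L[ℝ] Pl} (h : ∀ u, A (B u) = u) : dt A ≠ 0 := by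
  intro h0
  have h1 := h (1, 0)
  have h2 := h (0, 1)
  rw [clm_apply A] at h1 h2
  have a1 := congrArg Prod.fst h1
  have a2 := congrArg Prod.snd h1
  have b1 := congrArg Prod.fst h2
  have b2 := congrArg Prod.snd h2
  simp at a1 a2 b1 b2
  unfold dt at h0
  have : ((A (1, 0)).1 * (A (0, 1)).2 - (A (1, 0)).2 * (A (0, 1)).1) * dt B = 1 := by
    unfold dt
    have q1 := congrArg₂ (fun s t : ℝ => s * t) a1 b2
    have q2 := congrArg₂ (fun s t : ℝ => s * t) a2 b1
    linear_combination q1 - q2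
  rw [h0] at this
  simp at this

lemma dt_pos (S : IsotopySetup) (p : Pl) : 0 < dt (fderiv ℝ (S.Ft 1) p) := by
  have hne : ∀ t ∈ Icc (0:ℝ) 1, dt (fderiv ℝ (S.Ft t) p) ≠ 0 := by
    intro t ht
    obtain ⟨G, hG, h1, h2⟩ := S.Ft_diffeo t ht
    exact dt_ne (inv_fderiv (S.Ft_smooth t ht) hG h1 h2 p)
  have hc0 : ContinuousOn (fun t : ℝ => fderiv ℝ (S.Ft t) p) (Icc (0:ℝ) 1) := by
    have := S.DFt_cont.comp (f := fun t : ℝ => (t, p)) (s := Icc (0:ℝ) 1) (by fun_prop)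
      (fun t ht => ⟨ht, mem_univ _⟩)
    exact this
  have hc : ContinuousOn (fun t : ℝ => dt (fderiv ℝ (S.Ft t) p)) (Icc (0:ℝ) 1) := by
    unfold dt
    fun_prop
  have h00 : dt (fderiv ℝ (S.Ft 0) p) = 1 := by
    rw [S.Ft_zero]; simp [dt]
  by_contra! hle
  obtain ⟨t, ht, ht0⟩ := intermediate_value_Icc' (zero_le_one) hc
    (show (0:ℝ) ∈ Icc _ _ from ⟨hle, by simp only [h00]; exact zero_le_one⟩)
  exact hne t ht ht0

lemma hasDerivAt_vert {H : Pl → Pl} (hH : ContDiff ℝ 1 H) (x y : ℝ) :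
    HasDerivAt (fun y => (H (x, y)).1) (fderiv ℝ H (x, y) (0, 1)).1 y := by
  have h1 := (hH.differentiable one_ne_zero (x, y)).hasFDerivAt
  have h2 : HasDerivAt (fun y : ℝ => ((x, y) : Pl)) (0, 1) y :=
    (hasDerivAt_const y x).prodMk (hasDerivAt_id y)
  have h3 := h1.comp_hasDerivAt y h2
  exact (hasFDerivAt_fst (𝕜 := ℝ) (p := H (x, y))).comp_hasDerivAt y h3

lemma tw_all (S : IsotopySetup) (htwist : S.PosTwist) (hnc : S.NoConjPts) {G : Pl → Pl}
    (hG : ContDiff ℝ 1 G) (hGF : LeftInverse G S.F) (hFG : RightInverse G S.F) :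
    ∀ n, 1 ≤ n → Tw S.F G n := by
  have hF : ContDiff ℝ 1 S.F := S.Ft_smooth 1 (by simp)
  have hFs : ∀ p : Pl, S.F (p + (1, 0)) = S.F p + (1, 0) := S.Ft_periodic 1
  have hGs : ∀ p : Pl, G (p + (1, 0)) = G p + (1, 0) := by
    intro p
    have := hGF (G p + (1, 0))
    rw [hFs, hFG p] at this
    exact this
  have hinj : ∀ n, 1 ≤ n → ∀ x, Injective (fun y => (S.F^[n] (x, y)).1) := by
    intro n hn x
    have hFn : ContDiff ℝ 1 (S.F^[n]) := by
      clear hn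
      induction n with
      | zero => exact contDiff_id
      | succ k ih => rw [iterate_succ]; exact ih.comp hF
    have hd := fun y => hasDerivAt_vert hFn x y
    have aux : ∀ y y' : ℝ, y < y' → (S.F^[n] (x, y)).1 ≠ (S.F^[n] (x, y')).1 := by
      intro y y' hlt he
      obtain ⟨c, -, hc⟩ := exists_hasDerivAt_eq_zero hlt
        (fun t _ => (hd t).continuousAt.continuousWithinAt) he (fun t _ => hd t)
      exact hnc _ n hn hc
    intro y y' he
    by_contra hne
    rcases lt_or_gt_of_ne hne with h | h
    · exact aux _ _ h he
    · exact aux _ _ h he.symm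
  have h1 : Tw S.F G 1 := by
    refine ⟨fun x => ⟨(htwist x).1, (htwist x).2.1⟩, ?_⟩
    intro X
    have hinjG : Injective (fun Y => (G^[1] (X, Y)).1) := by
      intro Y Y' h
      simp only [iterate_one] at h
      have h2 : (G (X, Y)).2 = (G (X, Y')).2 := by
        apply (htwist (G (X, Y)).1).1.injective
        simp only
        rw [Prod.mk.eta, hFG, h, Prod.mk.eta, hFG]
      have h3 := hFG.injective (Prod.ext h h2)
      exact congrArg Prod.snd h3
    have hd := fun Y => hasDerivAt_vert hG X Y
    have hcont : Continuous (fun Y => (G^[1] (X, Y)).1) := by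
      have := hG.continuous
      simp only [iterate_one]
      fun_prop
    rcases hcont.strictMono_of_inj hinjG with hm | ha
    · exfalso
      have hnn := hm.monotone.deriv_nonneg (x := 0)
      have e1 : deriv (fun Y => (G^[1] (X, Y)).1) 0 = _ := (hd 0).deriv
      rw [e1] at hnn
      have hpos := dt_pos S (G (X, 0))
      have hb := (htwist (G (X, 0)).1).2.2 (G (X, 0)).2
      rw [(hasDerivAt_vert hF _ _).deriv, Prod.mk.eta] at hb
      have hi := inv_fderiv hF hG hGF hFG (G (X, 0)) (0, 1)
      rw [hFG, clm_apply] at hi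
      have c1 := congrArg Prod.fst hi
      have c2 := congrArg Prod.snd hi
      simp at c1 c2
      change 0 < dt (fderiv ℝ S.F (G (X, 0))) at hpos
      have : dt (fderiv ℝ S.F (G (X, 0))) * (fderiv ℝ G (X, 0) (0, 1)).1
          = - (fderiv ℝ S.F (G (X, 0)) (0, 1)).1 := by
        unfold dt
        linear_combination (fderiv ℝ S.F (G (X, 0)) (0, 1)).2 * c1
          - (fderiv ℝ S.F (G (X, 0)) (0, 1)).1 * c2
      have := mul_nonneg hpos.le hnn
      linarith
    · exact ha
  intro n hn
  induction n, hn using Nat.le_induction with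
  | base => exact h1
  | succ n _ ih =>
    exact tw_step hF.continuous hG.continuous hGF hFG hFs hGs hinj h1 n ih

end TwistAux

/-- Let `f` be a positive twist map with no conjugate points, `x₁ < x₂`,
with `Ψ₁(x₁) < Ψ₋₁(x₁)` and `Ψ₋₁(x₂) < Ψ₁(x₂)` (here `Ψm` plays the role of `Ψ₋₁`). Then
either every forward iterate of the segment over `x₁` stays to the left of `x₂`, or every
backward iterate of the segment over `x₂` stays to the right of `x₁`. -/
theorem statement11 (S : IsotopySetup) (htwist : S.PosTwist) (hnc : S.NoConjPts)
    (Ψ₁ Ψm : ℝ → ℝ) (hΨ₁C : ContDiff ℝ 1 Ψ₁) (hΨmC : ContDiff ℝ 1 Ψm)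
    (hΨ₁per : ∀ x : ℝ, Ψ₁ (x + 1) = Ψ₁ x) (hΨmper : ∀ x : ℝ, Ψm (x + 1) = Ψm x)
    (hΨ₁ : ∀ p : Pl, (S.F p).1 = p.1 ↔ p.2 = Ψ₁ p.1)
    (hΨm : ∀ p : Pl, (Function.invFun S.F p).1 = p.1 ↔ p.2 = Ψm p.1)
    (x₁ x₂ : ℝ) (hx : x₁ < x₂) (h₁ : Ψ₁ x₁ < Ψm x₁) (h₂ : Ψm x₂ < Ψ₁ x₂) :
    (∀ y ∈ Icc (Ψ₁ x₁) (Ψm x₁), ∀ n : ℕ, (S.F^[n] (x₁, y)).1 < x₂) ∨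
    (∀ y ∈ Icc (Ψm x₂) (Ψ₁ x₂), ∀ n : ℕ, x₁ < ((Function.invFun S.F)^[n] (x₂, y)).1) := by
  have hF1 : ∃ G : Pl → Pl, ContDiff ℝ 1 G ∧ LeftInverse G S.F ∧ RightInverse G S.F :=
    S.Ft_diffeo 1 (by simp)
  obtain ⟨G, hG, hGF, hFG⟩ := hF1
  have hinv : Function.invFun S.F = G := by
    funext p
    have h := Function.leftInverse_invFun hGF.injective (G p)
    rwa [hFG p] at h
  rw [hinv] at hΨm ⊢
  have htw := TwistAux.tw_all S htwist hnc hG hGF hFG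
  by_contra! hcon
  obtain ⟨⟨y, hy, n, hn⟩, y', hy', m, hm⟩ := hcon
  have hA := fun x => (htwist x).1.monotone
  have hB : ∀ x, Antitone (fun y => (G (x, y)).1) := fun x => ((htw 1 le_rfl).2 x).antitone
  have f1 := (hΨ₁ (x₁, Ψ₁ x₁)).2 rfl
  have f2 := (hΨ₁ (x₂, Ψ₁ x₂)).2 rfl
  have g1 := (hΨm (x₁, Ψm x₁)).2 rfl
  have g2 := (hΨm (x₂, Ψm x₂)).2 rfl
  have i1 := hA x₁ hy.1
  have i2 := hB x₁ hy.2
  have i3 := hA x₂ hy'.2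
  have i4 := hB x₂ hy'.1
  simp only at f1 f2 g1 g2 i1 i2 i3 i4
  rw [f1] at i1
  rw [f2] at i3
  rw [g1] at i2
  rw [g2] at i4
  exact TwistAux.core hGF hFG htw (x₁, y) (x₂, y') hx i1 i2 i3 i4 n m hn hm

end
end

section
/- Let f : 𝔸 → 𝔸 be an exact symplectic positive twist map with no conjugate points, and let F : ℝ² → ℝ² be a lift of f. Then C̃_F = {z ∈ ℝ² : p₁(F(z)) = p₁(z)} coincides with the fixed point set {z ∈ ℝ² : F(z) = z}. -/
noncomputable section

open MeasureTheory Set Filter Topology Function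

theorem aux_gen (F : ℝ × ℝ → ℝ × ℝ) (hF : ContDiff ℝ 1 F)
    (hper : ∀ p : ℝ × ℝ, F (p + (1, 0)) = F p + (1, 0))
    (htw : ∀ x : ℝ, StrictMono (fun y => (F (x, y)).1) ∧
      Function.Surjective (fun y => (F (x, y)).1) ∧
      ∀ y : ℝ, 0 < deriv (fun y => (F (x, y)).1) y)
    (Sg : ℝ × ℝ → ℝ) (hS : ContDiff ℝ 1 Sg) (hSper : ∀ p : ℝ × ℝ, Sg (p + (1, 0)) = Sg p)
    (hSd : ∀ p : ℝ × ℝ,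
      fderiv ℝ Sg p (1, 0) = (F p).2 * (fderiv ℝ F p (1, 0)).1 - p.2 ∧
      fderiv ℝ Sg p (0, 1) = (F p).2 * (fderiv ℝ F p (0, 1)).1) :
    ∃ (y : ℝ → ℝ → ℝ) (h : ℝ × ℝ → ℝ), (∀ x X, (F (x, y x X)).1 = X) ∧
      (∀ x X, h (x + 1, X + 1) = h (x, X)) ∧
      (∀ x X, HasFDerivAt h ((F (x, y x X)).2 • ContinuousLinearMap.snd ℝ ℝ ℝ
        - (y x X) • ContinuousLinearMap.fst ℝ ℝ ℝ) (x, X)) := by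
  have hFd : Differentiable ℝ F := hF.differentiable (by norm_num)
  have hSdf : Differentiable ℝ Sg := hS.differentiable (by norm_num)
  choose y hy using fun x X => (htw x).2.1 X
  simp only at hy
  have hyu : ∀ x t, y x (F (x, t)).1 = t := fun x t => (htw x).1.injective (hy x _)
  have hpos : ∀ p : ℝ × ℝ, 0 < (fderiv ℝ F p (0, 1)).1 := by
    rintro ⟨x, t⟩
    have h1 : HasDerivAt (fun s : ℝ => (x, s)) ((0 : ℝ), (1 : ℝ)) t :=
      (hasDerivAt_const t x).prodMk (hasDerivAt_id t)
    have h2 := ((hFd (x, t)).hasFDerivAt).comp_hasDerivAt t h1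
    have h3 := (hasFDerivAt_fst (𝕜 := ℝ) (p := F (x, t))).comp_hasDerivAt t h2
    have h4 := h3.deriv
    have h5 := (htw x).2.2 t
    have h6 : (fun y => (F (x, y)).1) = (Prod.fst ∘ F ∘ fun s => (x, s)) := rfl
    rw [h6, h4] at h5
    simpa using h5
  let Φ : ℝ × ℝ → ℝ × ℝ := fun p => (p.1, (F p).1)
  have hΦ : ContDiff ℝ 1 Φ := contDiff_fst.prodMk (contDiff_fst.comp hF)
  let L : ℝ × ℝ → (ℝ × ℝ →L[ℝ] ℝ × ℝ) := fun p =>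
    (ContinuousLinearMap.fst ℝ ℝ ℝ).prod ((ContinuousLinearMap.fst ℝ ℝ ℝ).comp (fderiv ℝ F p))
  have hL : ∀ p, HasFDerivAt Φ (L p) p := fun p =>
    hasFDerivAt_fst.prodMk (hasFDerivAt_fst.comp p (hFd p).hasFDerivAt)
  have hLinj : ∀ p, Function.Injective (L p) := by
    intro p
    rw [injective_iff_map_eq_zero]
    rintro ⟨a, b⟩ hab
    have h1 : a = 0 := congrArg Prod.fst hab
    subst h1
    have h2 : (fderiv ℝ F p (0, b)).1 = 0 := congrArg Prod.snd hab
    have h3 : ((0 : ℝ), b) = b • ((0 : ℝ), (1 : ℝ)) := by simp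
    rw [h3, map_smul] at h2
    have h4 := hpos p
    simp only [Prod.smul_fst, smul_eq_mul, mul_eq_zero, h4.ne', or_false] at h2
    simp [h2]
  let E : ℝ × ℝ → ((ℝ × ℝ) ≃L[ℝ] ℝ × ℝ) := fun p =>
    (LinearEquiv.ofInjectiveEndo (L p : ℝ × ℝ →ₗ[ℝ] ℝ × ℝ) (hLinj p)).toContinuousLinearEquiv
  have hE : ∀ p, (E p : ℝ × ℝ →L[ℝ] ℝ × ℝ) = L p := by
    intro p; ext <;> rfl
  have hEd : ∀ p, HasFDerivAt Φ (E p : ℝ × ℝ →L[ℝ] ℝ × ℝ) p := fun p => by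
    rw [hE]; exact hL p
  have hopen : IsOpenMap Φ := isOpenMap_of_hasStrictFDerivAt_equiv (f' := E) fun p =>
    (hΦ.contDiffAt).hasStrictFDerivAt' (hEd p) (by norm_num)
  let Ψ : ℝ × ℝ → ℝ × ℝ := fun q => (q.1, y q.1 q.2)
  let e : ℝ × ℝ ≃ ℝ × ℝ :=
    { toFun := Φ, invFun := Ψ
      left_inv := fun p => by simp [Φ, Ψ, hyu]
      right_inv := fun q => by simp [Φ, Ψ, hy] }
  let H : ℝ × ℝ ≃ₜ ℝ × ℝ := e.toHomeomorphOfContinuousOpen hΦ.continuous hopen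
  have hΨ : ContDiff ℝ 1 Ψ := H.contDiff_symm (f₀' := E) hEd hΦ
  have hΨd : Differentiable ℝ Ψ := hΨ.differentiable (by norm_num)
  have hSd' : ∀ p v, fderiv ℝ Sg p v = (F p).2 * (fderiv ℝ F p v).1 - p.2 * v.1 := by
    rintro p ⟨a, b⟩
    have h3 : (a, b) = a • ((1 : ℝ), (0 : ℝ)) + b • ((0 : ℝ), (1 : ℝ)) := by simp
    rw [h3, map_add, map_smul, map_smul, map_add, map_smul, map_smul, (hSd p).1, (hSd p).2]
    simp
    ring
  refine ⟨y, fun q => Sg (Ψ q), hy, ?_, ?_⟩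
  · intro x X
    have h1 : Ψ (x + 1, X + 1) = Ψ (x, X) + (1, 0) := by
      simp only [Ψ, Prod.mk_add_mk, add_zero]
      congr 1
      have h2 := hper (x, y x X)
      have h3 := hyu (x + 1) (y x X)
      simp only [Prod.mk_add_mk, add_zero] at h2
      rw [h2] at h3
      simpa [hy] using h3
    simp only [h1, hSper]
  · intro x X
    have h1 := (hSdf (Ψ (x, X))).hasFDerivAt.comp (x, X) (hΨd (x, X)).hasFDerivAt
    have h2 := (hL (Ψ (x, X))).comp (x, X) (hΨd (x, X)).hasFDerivAt
    have h3 : Φ ∘ Ψ = id := funext fun q => e.right_inv q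
    rw [h3] at h2
    have h4 := h2.unique (hasFDerivAt_id (x, X))
    refine h1.congr_fderiv (ContinuousLinearMap.ext fun v => ?_)
    have h5 : L (Ψ (x, X)) (fderiv ℝ Ψ (x, X) v) = v :=
      congrArg (fun T : ℝ × ℝ →L[ℝ] ℝ × ℝ => T v) h4
    have h6 : (fderiv ℝ Ψ (x, X) v).1 = v.1 :=
      (congrArg Prod.fst h5 : (L (Ψ (x, X)) (fderiv ℝ Ψ (x, X) v)).1 = v.1)
    have h7 : (fderiv ℝ F (Ψ (x, X)) (fderiv ℝ Ψ (x, X) v)).1 = v.2 :=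
      (congrArg Prod.snd h5 : (L (Ψ (x, X)) (fderiv ℝ Ψ (x, X) v)).2 = v.2)
    simp only [ContinuousLinearMap.comp_apply, hSd', h6, h7]
    simp [Ψ]

theorem aux_inj (F : ℝ × ℝ → ℝ × ℝ) (hF : ContDiff ℝ 1 F) (n : ℕ)
    (hn : ∀ p : ℝ × ℝ, ((fderiv ℝ (F^[n]) p) (0, 1)).1 ≠ 0) (x : ℝ) :
    Function.Injective (fun t => (F^[n] (x, t)).1) := by
  have hFn : ContDiff ℝ 1 (F^[n]) := by
    induction n with
    | zero => exact contDiff_id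
    | succ k ih =>
      clear hn ih
      induction k with
      | zero => simpa using hF
      | succ k ih => rw [Function.iterate_succ]; exact ih.comp hF
  have hFd : Differentiable ℝ (F^[n]) := hFn.differentiable (by norm_num)
  have hd : ∀ t, HasDerivAt (fun t => (F^[n] (x, t)).1) ((fderiv ℝ (F^[n]) (x, t)) (0, 1)).1 t := by
    intro t
    have h1 : HasDerivAt (fun s : ℝ => (x, s)) ((0 : ℝ), (1 : ℝ)) t :=
      (hasDerivAt_const t x).prodMk (hasDerivAt_id t)
    have h2 := ((hFd (x, t)).hasFDerivAt).comp_hasDerivAt t h1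
    exact (hasFDerivAt_fst (𝕜 := ℝ) (p := F^[n] (x, t))).comp_hasDerivAt t h2
  have hc : Continuous (fun t => (F^[n] (x, t)).1) :=
    continuous_iff_continuousAt.2 fun t => (hd t).continuousAt
  have key : ∀ s t, s < t → (F^[n] (x, s)).1 ≠ (F^[n] (x, t)).1 := by
    intro s t hst heq
    obtain ⟨c, -, hc⟩ := exists_deriv_eq_zero hst hc.continuousOn heq
    rw [(hd c).deriv] at hc
    exact hn _ hc
  intro s t hst
  rcases lt_trichotomy s t with h | h | h
  · exact (key s t h hst).elim
  · exact h
  · exact (key t s h hst.symm).elim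

/-- coercivity of the generating function -/
theorem aux_coer (F : ℝ × ℝ → ℝ × ℝ) (hF : Continuous F)
    (hper : ∀ p : ℝ × ℝ, F (p + (1, 0)) = F p + (1, 0))
    (hmono : ∀ x : ℝ, StrictMono (fun y => (F (x, y)).1))
    (y : ℝ → ℝ → ℝ) (h : ℝ × ℝ → ℝ) (hy : ∀ x X, (F (x, y x X)).1 = X)
    (hhper : ∀ x X, h (x + 1, X + 1) = h (x, X))
    (hd : ∀ x X, HasFDerivAt h ((F (x, y x X)).2 • ContinuousLinearMap.snd ℝ ℝ ℝ
        - (y x X) • ContinuousLinearMap.fst ℝ ℝ ℝ) (x, X)) :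
    ∃ C : ℝ, ∀ x X, |X - x| - C ≤ h (x, X) := by
  have bdd : ∀ K : ℝ, ∃ R : ℝ, ∀ x, |(F (x, K)).1 - x| ≤ R := by
    intro K
    have hc : Continuous (fun x : ℝ => (F (x, K)).1 - x) := by fun_prop
    have hp : Function.Periodic (fun x : ℝ => (F (x, K)).1 - x) 1 := by
      intro x
      have := hper (x, K)
      simp only [Prod.mk_add_mk, add_zero] at this
      simp [this]
    obtain ⟨R, hR⟩ := (hp.compact_of_continuous one_ne_zero hc).isBounded.exists_norm_le
    exact ⟨R, fun x => by simpa using hR _ (mem_range_self x)⟩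
  obtain ⟨R1, hR1⟩ := bdd 1
  obtain ⟨R2, hR2⟩ := bdd (-1)
  obtain ⟨R, hRR1, hRR2, hR0⟩ : ∃ R, R1 ≤ R ∧ R2 ≤ R ∧ 0 ≤ R :=
    ⟨max (max R1 R2) 0, by simp, by simp, by simp⟩
  have up : ∀ x X, x ≤ X - R → 1 ≤ y x X := by
    intro x X hx
    refine (hmono x).le_iff_le.1 ?_
    simp only [hy]
    have := abs_le.1 (hR1 x)
    linarith [this.2]
  have dn : ∀ x X, X + R ≤ x → y x X ≤ -1 := by
    intro x X hx
    refine (hmono x).le_iff_le.1 ?_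
    simp only [hy]
    have := abs_le.1 (hR2 x)
    linarith [this.1]
  have hcont : Continuous h :=
    continuous_iff_continuousAt.2 fun ⟨x, X⟩ => (hd x X).continuousAt
  have hdx : ∀ x X, HasDerivAt (fun s => h (s, X)) (-(y x X)) x := by
    intro x X
    have h1 : HasDerivAt (fun s : ℝ => (s, X)) ((1 : ℝ), (0 : ℝ)) x :=
      (hasDerivAt_id x).prodMk (hasDerivAt_const x X)
    have h2 := (hd x X).comp_hasDerivAt x h1
    exact h2.congr_deriv (by simp)
  -- bound on the strip
  obtain ⟨C0, hC0⟩ : ∃ C0, ∀ x X, |X - x| ≤ R → |h (x, X)| ≤ C0 := by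
    have hK : IsCompact (Icc (0 : ℝ) 1 ×ˢ Icc (-R) R) := isCompact_Icc.prod isCompact_Icc
    have hc : Continuous (fun q : ℝ × ℝ => h (q.1, q.1 + q.2)) := by fun_prop
    obtain ⟨C0, hC0⟩ := (hK.image hc).isBounded.exists_norm_le
    refine ⟨C0, fun x X hx => ?_⟩
    have hp : Function.Periodic (fun s : ℝ => h (s, s + (X - x))) 1 := by
      intro s
      have := hhper s (s + (X - x))
      simp only [← this]
      congr 2; ring
    have h1 : h (Int.fract x, Int.fract x + (X - x)) = h (x, X) := by
      have h2 := hp.sub_int_mul_eq (x := x) ⌊x⌋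
      simp only [mul_one, Int.self_sub_floor] at h2
      rw [h2]; congr 2; ring
    rw [← h1]
    have h3 := hC0 (h (Int.fract x, Int.fract x + (X - x)))
      ⟨(Int.fract x, X - x), ⟨⟨Int.fract_nonneg x, (Int.fract_lt_one x).le⟩, abs_le.1 hx⟩, rfl⟩
    simpa using h3
  refine ⟨C0 + R, fun x X => ?_⟩
  by_cases hx : |X - x| ≤ R
  · have := (abs_le.1 (hC0 x X hx)).1
    linarith
  · rw [not_le] at hx
    rcases lt_abs.1 hx with hx | hx
    · have hs := (abs_le.1 (hC0 (X - R) X (by rw [abs_le]; constructor <;> linarith))).1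
      have h1 := Convex.image_sub_le_mul_sub_of_deriv_le (convex_Iic (X - R))
        (f := fun s => h (s, X)) (C := -1) (by fun_prop)
        (fun s _ => (hdx s X).differentiableAt.differentiableWithinAt)
        (fun s hs' => by
          rw [(hdx s X).deriv]
          have := up s X (mem_Iic.1 (interior_subset hs'))
          linarith) x (by simp only [mem_Iic]; linarith) (X - R) (by simp) (by linarith)
      rw [abs_of_nonneg (by linarith)]
      linarith
    · have hs := (abs_le.1 (hC0 (X + R) X (by rw [abs_le]; constructor <;> linarith))).1
      have h1 := Convex.mul_sub_le_image_sub_of_le_deriv (convex_Ici (X + R))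
        (f := fun s => h (s, X)) (C := 1) (by fun_prop)
        (fun s _ => (hdx s X).differentiableAt.differentiableWithinAt)
        (fun s hs' => by
          rw [(hdx s X).deriv]
          have := dn s X (mem_Ici.1 (interior_subset hs'))
          linarith) (X + R) (by simp) x (by simp only [mem_Ici]; linarith) (by linarith)
      rw [abs_of_nonpos (by linarith)]
      linarith

/-- minimality of constant configurations at fixed points -/
theorem aux_min (F : ℝ × ℝ → ℝ × ℝ)
    (y : ℝ → ℝ → ℝ) (h : ℝ × ℝ → ℝ) (hy : ∀ x X, (F (x, y x X)).1 = X)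
    (hd : ∀ x X, HasFDerivAt h ((F (x, y x X)).2 • ContinuousLinearMap.snd ℝ ℝ ℝ
        - (y x X) • ContinuousLinearMap.fst ℝ ℝ ℝ) (x, X))
    (C : ℝ) (hC : ∀ x X, |X - x| - C ≤ h (x, X))
    (n : ℕ) (a c : ℝ) (hfix : F (a, c) = (a, c))
    (hinj : Function.Injective (fun t => (F^[n] (a, t)).1))
    (v : ℕ → ℝ) (hv0 : v 0 = a) (hvn : v n = a) :
    n * h (a, a) ≤ ∑ i ∈ Finset.range n, h (v i, v (i + 1)) := by
  classical
  have hcont : Continuous h :=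
    continuous_iff_continuousAt.2 fun ⟨x, X⟩ => (hd x X).continuousAt
  set A : (ℕ → ℝ) → ℝ := fun u => ∑ i ∈ Finset.range n, h (u i, u (i + 1)) with hA
  have hAc : Continuous A := by
    refine continuous_finsetSum _ fun i _ => hcont.comp ?_
    exact (continuous_apply i).prodMk (continuous_apply (i + 1))
  -- bound
  have hbound : ∀ u : ℕ → ℝ, u 0 = a → ∀ i ≤ n, |u i - a| ≤ A u + n * C := by
    intro u hu0 i hi
    have h1 : ∀ k, |u k - a| ≤ ∑ j ∈ Finset.range k, |u (j + 1) - u j| := by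
      intro k
      induction k with
      | zero => simp [hu0]
      | succ k ih =>
        rw [Finset.sum_range_succ]
        have := abs_sub_le (u (k + 1)) (u k) a
        linarith
    have h2 : ∑ j ∈ Finset.range i, |u (j + 1) - u j| ≤ ∑ j ∈ Finset.range n, |u (j + 1) - u j| :=
      Finset.sum_le_sum_of_subset_of_nonneg (by simpa using hi) (fun _ _ _ => abs_nonneg _)
    have h3 : ∑ j ∈ Finset.range n, |u (j + 1) - u j| ≤
        ∑ j ∈ Finset.range n, (h (u j, u (j + 1)) + C) :=
      Finset.sum_le_sum fun j _ => by linarith [hC (u j) (u (j + 1))]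
    rw [Finset.sum_add_distrib] at h3
    simp only [Finset.sum_const, Finset.card_range, nsmul_eq_mul] at h3
    linarith [h1 i]
  set R := A v + n * C + 1 with hR
  have hR1 : 1 ≤ R := by
    have := hbound v hv0 0 (Nat.zero_le _)
    rw [hv0] at this
    simp at this
    linarith
  let K : Set (ℕ → ℝ) := (Set.univ.pi fun _ => Icc (a - R) (a + R)) ∩ {u | u 0 = a ∧ u n = a}
  have hK : IsCompact K := by
    refine (isCompact_univ_pi fun _ => isCompact_Icc).inter_right ?_
    exact (isClosed_eq (continuous_apply 0) continuous_const).inter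
      (isClosed_eq (continuous_apply n) continuous_const)
  -- truncated comparison sequence
  let v' : ℕ → ℝ := fun i => if i ≤ n then v i else a
  have hAv' : A v' = A v := by
    refine Finset.sum_congr rfl fun i hi => ?_
    have := Finset.mem_range.1 hi
    have h1 : i ≤ n := by omega
    have h2 : i + 1 ≤ n := by omega
    simp [v', h1, h2]
  have hv'K : v' ∈ K := by
    refine ⟨fun i _ => ?_, by simp [v', hv0], by simp [v', hvn]⟩
    by_cases hi : i ≤ n
    · have := abs_le.1 (hbound v hv0 i hi)
      simp only [v', hi, if_true, mem_Icc]
      constructor <;> linarith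
    · simp only [v', hi, if_false, mem_Icc]
      constructor <;> linarith
  obtain ⟨u, huK, hu⟩ := hK.exists_isMinOn ⟨v', hv'K⟩ hAc.continuousOn
  have hu0 : u 0 = a := huK.2.1
  have hun : u n = a := huK.2.2
  have huv : A u ≤ A v := hAv' ▸ hu hv'K
  have crit : ∀ i, i + 1 < n → (F (u i, y (u i) (u (i + 1)))).2 = y (u (i + 1)) (u (i + 2)) := by
    intro i hi
    have hdA : HasDerivAt (fun t => A (Function.update u (i + 1) t))
        (∑ j ∈ Finset.range n, ((if j = i then (F (u j, y (u j) (u (j + 1)))).2 else 0)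
          - (if j = i + 1 then y (u j) (u (j + 1)) else 0))) (u (i + 1)) := by
      refine HasDerivAt.fun_sum fun j _ => ?_
      have e1 : ∀ k : ℕ, HasDerivAt (fun t => Function.update u (i + 1) t k)
          (if k = i + 1 then 1 else 0) (u (i + 1)) := by
        intro k
        by_cases hk : k = i + 1
        · subst hk
          simpa using hasDerivAt_id' (u (i + 1))
        · simpa [Function.update_of_ne hk, hk] using hasDerivAt_const (u (i + 1)) (u k)
      have e2 := (e1 j).prodMk (e1 (j + 1))
      have e3 := hd (u j) (u (j + 1))
      have e4 : (u j, u (j + 1)) = (Function.update u (i + 1) (u (i + 1)) j,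
        Function.update u (i + 1) (u (i + 1)) (j + 1)) := by simp
      rw [e4] at e3
      have e5 := e3.comp_hasDerivAt (u (i + 1)) e2
      exact e5.congr_deriv (by simp)
    have hmin : IsLocalMin (fun t => A (Function.update u (i + 1) t)) (u (i + 1)) := by
      have hb := abs_le.1 (hbound u hu0 (i + 1) hi.le)
      have hmem : Ioo (a - R) (a + R) ∈ 𝓝 (u (i + 1)) :=
        Ioo_mem_nhds (by linarith) (by linarith)
      filter_upwards [hmem] with t ht
      simp only [Function.update_eq_self]
      refine hu ⟨fun k _ => ?_, ?_, ?_⟩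
      · by_cases hk : k = i + 1
        · subst hk; rw [Function.update_self]; exact ⟨ht.1.le, ht.2.le⟩
        · rw [Function.update_of_ne hk]; exact huK.1 k (mem_univ _)
      · rw [Function.update_of_ne (by omega)]; exact hu0
      · rw [Function.update_of_ne (by omega)]; exact hun
    have h0 := hmin.hasDerivAt_eq_zero hdA
    rw [Finset.sum_sub_distrib, Finset.sum_ite_eq', Finset.sum_ite_eq'] at h0
    simp only [Finset.mem_range, hi, Nat.lt_of_succ_lt hi, if_true] at h0
    linarith
  have horb : ∀ j, j < n → F^[j] (u 0, y (u 0) (u 1)) = (u j, y (u j) (u (j + 1))) := by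
    intro j
    induction j with
    | zero => intro _; rfl
    | succ j ih =>
      intro hj
      rw [Function.iterate_succ_apply', ih (by omega)]
      exact Prod.ext (hy _ _) (crit j hj)
  rcases Nat.eq_zero_or_pos n with hn | hn
  · subst hn; simp
  have hfixn : ∀ j, F^[j] (a, c) = (a, c) := fun j => Function.iterate_fixed hfix j
  have hend : (F^[n] (a, y (u 0) (u 1))).1 = a := by
    obtain ⟨m, rfl⟩ : ∃ m, n = m + 1 := ⟨n - 1, by omega⟩
    rw [← hu0, Function.iterate_succ_apply', horb m (by omega)]
    simp only [hy, hun, hu0]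
  have hyc : y (u 0) (u 1) = c := hinj (by simp only [hend, hfixn])
  have hall : ∀ j, j ≤ n → u j = a := by
    intro j hj
    rcases hj.lt_or_eq with hj | rfl
    · have := horb j hj
      rw [hyc, hu0, hfixn] at this
      exact (congrArg Prod.fst this).symm
    · exact hun
  have hAu : A u = n * h (a, a) := by
    have : A u = ∑ i ∈ Finset.range n, h (a, a) := by
      refine Finset.sum_congr rfl fun i hi => ?_
      have := Finset.mem_range.1 hi
      rw [hall i (by omega), hall (i + 1) (by omega)]
    rw [this]; simp
  rw [← hAu]; exact huv

theorem aux_main (F : ℝ × ℝ → ℝ × ℝ) (hF : ContDiff ℝ 1 F)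
    (hper : ∀ p : ℝ × ℝ, F (p + (1, 0)) = F p + (1, 0))
    (htw : ∀ x : ℝ, StrictMono (fun y => (F (x, y)).1) ∧
      Function.Surjective (fun y => (F (x, y)).1) ∧
      ∀ y : ℝ, 0 < deriv (fun y => (F (x, y)).1) y)
    (hnc : ∀ p : ℝ × ℝ, ∀ n : ℕ, 1 ≤ n → ((fderiv ℝ (F^[n]) p) (0, 1)).1 ≠ 0)
    (Sg : ℝ × ℝ → ℝ) (hS : ContDiff ℝ 1 Sg) (hSper : ∀ p : ℝ × ℝ, Sg (p + (1, 0)) = Sg p)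
    (hSd : ∀ p : ℝ × ℝ,
      fderiv ℝ Sg p (1, 0) = (F p).2 * (fderiv ℝ F p (1, 0)).1 - p.2 ∧
      fderiv ℝ Sg p (0, 1) = (F p).2 * (fderiv ℝ F p (0, 1)).1)
    (p : ℝ × ℝ) (hp : (F p).1 = p.1) : F p = p := by
  obtain ⟨y, h, hy, hhper, hd⟩ := aux_gen F hF hper htw Sg hS hSper hSd
  obtain ⟨C, hC⟩ := aux_coer F hF.continuous hper (fun x => (htw x).1) y h hy hhper hd
  have hdd : ∀ t, HasDerivAt (fun s => h (s, s)) ((F (t, y t t)).2 - y t t) t := by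
    intro t
    have h1 : HasDerivAt (fun s : ℝ => (s, s)) ((1 : ℝ), (1 : ℝ)) t :=
      (hasDerivAt_id t).prodMk (hasDerivAt_id t)
    have h2 := HasFDerivAt.comp_hasDerivAt (f := fun s : ℝ => (s, s)) t (hd t t) h1
    exact h2.congr_deriv (by simp)
  have hcont : Continuous (fun s => h (s, s)) :=
    continuous_iff_continuousAt.2 fun t => (hdd t).continuousAt
  have hperd : Function.Periodic (fun s => h (s, s)) 1 := fun s => hhper s s
  obtain ⟨_, ⟨a, rfl⟩, ha⟩ := (hperd.compact_of_continuous one_ne_zero hcont).exists_isGreatest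
    (range_nonempty _)
  have hmax : ∀ b, h (b, b) ≤ h (a, a) := fun b => ha (mem_range_self b)
  have hfix : F (a, y a a) = (a, y a a) := by
    have h1 : IsLocalMax (fun s => h (s, s)) a := Filter.Eventually.of_forall hmax
    have h0 := h1.hasDerivAt_eq_zero (hdd a)
    exact Prod.ext (hy a a) (by simp only; linarith)
  have hconst : ∀ b, h (b, b) = h (a, a) := by
    intro b
    refine le_antisymm (hmax b) ?_
    by_contra hlt
    rw [not_le] at hlt
    have key : ∀ m : ℕ, ((m + 2 : ℕ) : ℝ) * h (a, a) ≤ h (a, b) + m * h (b, b) + h (b, a) := by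
      intro m
      have := aux_min F y h hy hd C hC (m + 2) a (y a a) hfix
        (aux_inj F hF (m + 2) (fun p => hnc p _ (by omega)) a)
        (fun i => if i = 0 ∨ i = m + 2 then a else b) (by simp) (by simp)
      rw [Finset.sum_range_succ, Finset.sum_range_succ'] at this
      have e : ∑ k ∈ Finset.range m, h ((if k + 1 = 0 ∨ k + 1 = m + 2 then a else b),
          (if k + 1 + 1 = 0 ∨ k + 1 + 1 = m + 2 then a else b)) = m * h (b, b) := by
        rw [Finset.sum_congr rfl (g := fun _ => h (b, b))]
        · simp
        · intro k hk
          have := Finset.mem_range.1 hk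
          rw [if_neg (by omega), if_neg (by omega)]
      rw [e] at this
      simp at this
      push_cast
      linarith
    obtain ⟨m, hm⟩ := exists_nat_gt ((h (a, b) + h (b, a) - 2 * h (a, a)) / (h (a, a) - h (b, b)))
    rw [div_lt_iff₀ (by linarith)] at hm
    have := key m
    push_cast at this
    nlinarith
  obtain ⟨x, t⟩ := p
  have ht : y x x = t := (htw x).1.injective (by simp only [hy]; exact hp.symm)
  have h0 : (F (x, y x x)).2 - y x x = 0 := by
    have h1 : (fun s => h (s, s)) = fun _ => h (a, a) := funext hconst
    have h2 := hdd x
    rw [h1] at h2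
    exact h2.unique (hasDerivAt_const x _)
  rw [ht] at h0
  exact Prod.ext hp (by simp only; linarith)

/-- For an exact symplectic positive twist map with no conjugate points,
the set `C̃_F = {z ∈ ℝ² : p₁(F(z)) = p₁(z)}` coincides with the set of fixed points of the
lift `F`. -/
theorem statement12 (S : IsotopySetup) (htwist : S.PosTwist)
    (hexact : S.ExactSymplectic) (hnc : S.NoConjPts) :
    {p : Pl | (S.F p).1 = p.1} = {p : Pl | S.F p = p} := by
  obtain ⟨-, Sg, hS, hSper, hSd⟩ := hexact
  ext p
  constructor
  · intro hp
    exact aux_main S.F (S.Ft_smooth 1 (by simp)) (S.Ft_periodic 1) htwist hnc Sg hS hSper hSd p hp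
  · intro hp
    exact congrArg Prod.fst hp

end
end

section
/- Let f : 𝔸 → 𝔸 be an exact symplectic positive twist map with no conjugate points, and let F be a lift of f. Then for every p ∈ ℤ and every q ∈ ℕ*, the set {z ∈ ℝ² : F^q(z) = z + (p,0)} is nonempty and is the graph of a C¹ function Ψ_{p/q} : ℝ → ℝ satisfying Ψ_{p/q}(x+1) = Ψ_{p/q}(x) for all x ∈ ℝ. -/
noncomputable section

open MeasureTheory Set Filter Topology Function

/-! ### Auxiliary material for the proof -/

/-- A `C¹` exact map with bijective horizontal displacement along vertical lines. -/
structure GoodMap (G : Pl → Pl) (σ : Pl → ℝ) : Prop where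
  smooth : ContDiff ℝ 1 G
  smoothS : ContDiff ℝ 1 σ
  exact' : ∀ p v : Pl, fderiv ℝ σ p v = (G p).2 * (fderiv ℝ G p v).1 - p.2 * v.1
  nc : ∀ p : Pl, (fderiv ℝ G p (0, 1)).1 ≠ 0
  surj : ∀ x X : ℝ, ∃ y : ℝ, (G (x, y)).1 = X

theorem vert_inj {G : Pl → Pl} (hG : ContDiff ℝ 1 G)
    (nc : ∀ p : Pl, (fderiv ℝ G p (0, 1)).1 ≠ 0) {x y y' : ℝ}
    (h : (G (x, y)).1 = (G (x, y')).1) : y = y' := by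
  have hd : ∀ t : ℝ, HasDerivAt (fun t => (G (x, t)).1) (fderiv ℝ G (x, t) (0, 1)).1 t := by
    intro t
    have h1 : HasDerivAt (fun t : ℝ => ((x, t) : Pl)) (0, 1) t :=
      (hasDerivAt_const t x).prodMk (hasDerivAt_id t)
    have h2 := ((hG.differentiable one_ne_zero) (x, t)).hasFDerivAt.comp_hasDerivAt t h1
    exact (hasFDerivAt_fst (𝕜 := ℝ) (E := ℝ) (F := ℝ)).comp_hasDerivAt t h2
  by_contra hne
  rcases lt_or_gt_of_ne hne with hlt | hlt
  · obtain ⟨c, -, hc⟩ := exists_hasDerivAt_eq_zero hlt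
      (fun t _ => (hd t).continuousAt.continuousWithinAt) h (fun t _ => hd t)
    exact nc _ hc
  · obtain ⟨c, -, hc⟩ := exists_hasDerivAt_eq_zero hlt
      (fun t _ => (hd t).continuousAt.continuousWithinAt) h.symm (fun t _ => hd t)
    exact nc _ hc

theorem good_inverse {G : Pl → Pl} {σ : Pl → ℝ} (H : GoodMap G σ) :
    ∃ Y : Pl → ℝ, ContDiff ℝ 1 Y ∧ (∀ x X, (G (x, Y (x, X))).1 = X) ∧
      (∀ x y, Y (x, (G (x, y)).1) = y) ∧
      ∀ w : Pl, HasFDerivAt (fun w : Pl => σ (w.1, Y w))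
        (-(Y w) • ContinuousLinearMap.fst ℝ ℝ ℝ +
          (G (w.1, Y w)).2 • ContinuousLinearMap.snd ℝ ℝ ℝ) w := by
  choose Y0 hY0 using H.surj
  have hYG : ∀ x y, Y0 x (G (x, y)).1 = y := fun x y => vert_inj H.smooth H.nc (hY0 _ _)
  set Φ : Pl → Pl := fun z => (z.1, (G z).1) with hΦ
  set I : Pl → Pl := fun w => (w.1, Y0 w.1 w.2) with hI
  have hΦI : ∀ w, Φ (I w) = w := fun w => Prod.ext rfl (hY0 _ _)
  have hIΦ : ∀ w, I (Φ w) = w := fun w => Prod.ext rfl (hYG _ _)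
  have hΦs : ContDiff ℝ 1 Φ := contDiff_fst.prodMk (contDiff_fst.comp H.smooth)
  have hdΦ : ∀ z : Pl, HasFDerivAt Φ ((ContinuousLinearMap.fst ℝ ℝ ℝ).prod
      ((ContinuousLinearMap.fst ℝ ℝ ℝ).comp (fderiv ℝ G z))) z := by
    intro z
    exact hasFDerivAt_fst.prodMk
      (hasFDerivAt_fst.comp z ((H.smooth.differentiable one_ne_zero) z).hasFDerivAt)
  have hinj : ∀ z : Pl, Function.Injective ((ContinuousLinearMap.fst ℝ ℝ ℝ).prod
      ((ContinuousLinearMap.fst ℝ ℝ ℝ).comp (fderiv ℝ G z)) : Pl →L[ℝ] Pl) := by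
    intro z
    rw [injective_iff_map_eq_zero]
    rintro ⟨v1, v2⟩ hv
    have e1 : v1 = 0 := congrArg Prod.fst hv
    have e2 : (fderiv ℝ G z (v1, v2)).1 = 0 := congrArg Prod.snd hv
    subst e1
    have : ((0, v2) : Pl) = v2 • ((0, 1) : Pl) := by simp
    rw [this, map_smul] at e2
    have e3 : v2 * (fderiv ℝ G z (0, 1)).1 = 0 := e2
    rcases mul_eq_zero.1 e3 with h | h
    · simp [h]
    · exact absurd h (H.nc z)
  have hIs : ContDiff ℝ 1 I := by
    rw [contDiff_iff_contDiffAt]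
    intro w
    set z := I w with hz
    let e : Pl ≃L[ℝ] Pl :=
      (LinearEquiv.ofInjectiveEndo _ (hinj z)).toContinuousLinearEquiv
    have he : HasFDerivAt Φ (e : Pl →L[ℝ] Pl) z := by
      have : (e : Pl →L[ℝ] Pl) = ((ContinuousLinearMap.fst ℝ ℝ ℝ).prod
        ((ContinuousLinearMap.fst ℝ ℝ ℝ).comp (fderiv ℝ G z))) := by
        ext <;> rfl
      rw [this]; exact hdΦ z
    have hs := (hΦs.contDiffAt (x := z)).to_localInverse he one_ne_zero
    have hstr := (hΦs.contDiffAt (x := z)).hasStrictFDerivAt' he one_ne_zero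
    have hzw : Φ z = w := hΦI w
    rw [hzw] at hs
    refine hs.congr_of_eventuallyEq ?_
    have hev := hstr.eventually_right_inverse
    rw [hzw] at hev
    filter_upwards [hev] with u hu
    have : I (Φ (hstr.localInverse Φ e z u)) = I u := by rw [hu]
    rw [hIΦ] at this
    exact this.symm
  refine ⟨fun w => Y0 w.1 w.2, contDiff_snd.comp hIs, hY0, hYG, ?_⟩
  intro w
  set z := I w with hz
  have hh : Differentiable ℝ (fun w : Pl => σ (I w)) :=
    (H.smoothS.comp hIs).differentiable one_ne_zero
  have hw := (hh w).hasFDerivAt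
  set T := fderiv ℝ (fun w : Pl => σ (I w)) w with hT
  have hcomp : HasFDerivAt (fun z => σ (I (Φ z))) (T.comp ((ContinuousLinearMap.fst ℝ ℝ ℝ).prod
      ((ContinuousLinearMap.fst ℝ ℝ ℝ).comp (fderiv ℝ G z)))) z := by
    have hw' : HasFDerivAt (fun w : Pl => σ (I w)) T (Φ z) := by rw [hΦI w]; exact hw
    exact hw'.comp z (hdΦ z)
  simp only [hIΦ] at hcomp
  have hfd : ∀ v : Pl, T (v.1, (fderiv ℝ G z v).1) = (G z).2 * (fderiv ℝ G z v).1 - z.2 * v.1 := by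
    intro v
    rw [← H.exact' z v, hcomp.fderiv]; rfl
  have hlin : ∀ a b : ℝ, T (a, b) = a * T (1, 0) + b * T (0, 1) := by
    intro a b
    have : ((a, b) : Pl) = a • ((1, 0) : Pl) + b • ((0, 1) : Pl) := by simp
    rw [this, map_add, map_smul, map_smul]; rfl
  have h01 := hfd (0, 1)
  have h10 := hfd (1, 0)
  rw [hlin] at h01 h10
  have k2 : T (0, 1) = (G z).2 := by
    apply mul_left_cancel₀ (H.nc z)
    simp only at h01; linarith
  have k1 : T (1, 0) = - z.2 := by
    rw [k2] at h10; simp only at h10; linarith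
  have : T = (-(Y0 w.1 w.2) • ContinuousLinearMap.fst ℝ ℝ ℝ +
          (G (w.1, Y0 w.1 w.2)).2 • ContinuousLinearMap.snd ℝ ℝ ℝ) := by
    refine ContinuousLinearMap.ext fun v => ?_
    obtain ⟨a, b⟩ := v
    rw [hlin, k1, k2]
    simp [hz, hI]; ring
  rw [← this]; exact hw

/-- Coercivity of the action. -/
def Coer (G : Pl → Pl) (σ : Pl → ℝ) : Prop :=
  ∃ C : ℝ, ∀ z : Pl, |z.1 - (G z).1| - C ≤ σ z

theorem good_comp {G G' : Pl → Pl} {σ σ' : Pl → ℝ} (H : GoodMap G σ) (H' : GoodMap G' σ')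
    (hC : Coer G σ) (hC' : Coer G' σ')
    (nc : ∀ p : Pl, (fderiv ℝ (G' ∘ G) p (0, 1)).1 ≠ 0) :
    GoodMap (G' ∘ G) (fun z => σ z + σ' (G z)) ∧ Coer (G' ∘ G) (fun z => σ z + σ' (G z)) ∧
    ∀ z z1 z2 : Pl, z1.1 = z.1 → (G z1).1 = z2.1 → (G' z2).1 = (G' (G z)).1 →
      σ z + σ' (G z) ≤ σ z1 + σ' z2 := by
  obtain ⟨C, hC⟩ := hC
  obtain ⟨C', hC'⟩ := hC'
  obtain ⟨Y, hYs, hY1, hY2, hYd⟩ := good_inverse H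
  obtain ⟨Y', hYs', hY1', hY2', hYd'⟩ := good_inverse H'
  have hsm : ContDiff ℝ 1 (G' ∘ G) := H'.smooth.comp H.smooth
  have hmin : ∀ x X : ℝ, ∃ y : ℝ, (G' (G (x, y))).1 = X ∧
      ∀ w : ℝ, σ (x, y) + σ' (G (x, y)) ≤ σ (x, Y (x, w)) + σ' (w, Y' (w, X)) := by
    intro x X
    set k : ℝ → ℝ := fun w => σ (x, Y (x, w)) + σ' (w, Y' (w, X)) with hk
    have hkd : ∀ w : ℝ, HasDerivAt k ((G (x, Y (x, w))).2 - Y' (w, X)) w := by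
      intro w
      have a1 : HasDerivAt (fun w : ℝ => ((x, w) : Pl)) (0, 1) w :=
        (hasDerivAt_const w x).prodMk (hasDerivAt_id w)
      have a2 : HasDerivAt (fun w : ℝ => ((w, X) : Pl)) (1, 0) w :=
        (hasDerivAt_id w).prodMk (hasDerivAt_const w X)
      have b1 := (hYd (x, w)).comp_hasDerivAt w a1
      have b2 := (hYd' (w, X)).comp_hasDerivAt w a2
      have := b1.add b2
      refine this.congr_deriv ?_
      simp; ring
    have hkc : Continuous k :=
      continuous_iff_continuousAt.2 fun w => (hkd w).continuousAt
    have hlow : ∀ w, |w - x| - (C + C') ≤ k w := by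
      intro w
      have e1 := hC (x, Y (x, w))
      have e2 := hC' (w, Y' (w, X))
      rw [hY1] at e1
      rw [abs_sub_comm]
      have := abs_nonneg ((w, Y' (w, X)).1 - (G' (w, Y' (w, X))).1)
      have e3 : k w = σ (x, Y (x, w)) + σ' (w, Y' (w, X)) := rfl
      rw [e3]
      linarith
    have htend : Tendsto k (cocompact ℝ) atTop := by
      refine tendsto_atTop_mono hlow ?_
      apply tendsto_atTop_add_const_right
      have := tendsto_norm_cocompact_atTop (E := ℝ)
      have h2 := this.comp ((Homeomorph.subRight x).isClosedEmbedding.tendsto_cocompact)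
      exact h2
    obtain ⟨w, hw⟩ := hkc.exists_forall_le htend
    have hcrit : (G (x, Y (x, w))).2 - Y' (w, X) = 0 :=
      IsLocalMin.hasDerivAt_eq_zero (Filter.Eventually.of_forall hw) (hkd w)
    have hGz : G (x, Y (x, w)) = (w, Y' (w, X)) := Prod.ext (hY1 x w) (by simpa using sub_eq_zero.1 hcrit)
    refine ⟨Y (x, w), ?_, ?_⟩
    · rw [hGz, hY1']
    · rw [hGz]; exact hw
  have hineq : ∀ z z1 z2 : Pl, z1.1 = z.1 → (G z1).1 = z2.1 → (G' z2).1 = (G' (G z)).1 →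
      σ z + σ' (G z) ≤ σ z1 + σ' z2 := by
    rintro ⟨x, y⟩ ⟨x1, y1⟩ ⟨x2, y2⟩ h1 h2 h3
    simp only at h1 h2
    subst h1
    obtain ⟨y0, e1, e2⟩ := hmin x1 (G' (G (x1, y))).1
    have : y0 = y := vert_inj hsm nc e1
    subst this
    have := e2 x2
    rw [← h3, hY2', ← h2, hY2] at this
    rw [← h2]; exact this
  refine ⟨⟨hsm, H.smoothS.add (H'.smoothS.comp H.smooth), ?_, nc, fun x X => ?_⟩, ?_, hineq⟩
  · intro p v
    have d1 := (H.smooth.differentiable one_ne_zero p).hasFDerivAt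
    have d2 := (H'.smooth.differentiable one_ne_zero (G p)).hasFDerivAt
    have s1 := (H.smoothS.differentiable one_ne_zero p).hasFDerivAt
    have s2 := (H'.smoothS.differentiable one_ne_zero (G p)).hasFDerivAt
    have t1 : fderiv ℝ (fun z => σ z + σ' (G z)) p = _ := (s1.add (s2.comp p d1)).fderiv
    have t2 : fderiv ℝ (G' ∘ G) p = _ := (d2.comp p d1).fderiv
    rw [t1, t2]
    simp only [add_apply, ContinuousLinearMap.comp_apply, H.exact', H'.exact',
      Function.comp]
    ring
  · obtain ⟨y, hy, -⟩ := hmin x X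
    exact ⟨y, hy⟩
  · refine ⟨C + C', fun z => ?_⟩
    have e1 := hC z
    have e2 := hC' (G z)
    have := abs_sub_le z.1 (G z).1 (G' (G z)).1
    simp only [Function.comp]
    linarith

theorem base_coer {G : Pl → Pl} {σ : Pl → ℝ} (H : GoodMap G σ)
    (hper : ∀ z, G (z + (1, 0)) = G z + (1, 0)) (hperS : ∀ z, σ (z + (1, 0)) = σ z)
    (hmono : ∀ x : ℝ, StrictMono fun y => (G (x, y)).1) : Coer G σ := by
  obtain ⟨Y, hYs, hY1, hY2, hYd⟩ := good_inverse H
  have hGc := H.smooth.continuous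
  have hbd : ∀ y : ℝ, ∃ R : ℝ, ∀ x, |(G (x, y)).1 - x| ≤ R := by
    intro y
    have hp : Function.Periodic (fun x : ℝ => (G (x, y)).1 - x) 1 := by
      intro x
      have := hper (x, y)
      simp only [Prod.mk_add_mk, add_zero] at this
      simp only [this, Prod.fst_add]; ring
    have hc : Continuous (fun x : ℝ => (G (x, y)).1 - x) := by fun_prop
    obtain ⟨R, hR⟩ := (hp.isBounded_of_continuous one_ne_zero hc).exists_norm_le
    exact ⟨R, fun x => hR _ ⟨x, rfl⟩⟩
  obtain ⟨R1, hR1⟩ := hbd 1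
  obtain ⟨R2, hR2⟩ := hbd (-1)
  set R := max (max R1 R2) 0 with hR
  have hR10 : R1 ≤ R := (le_max_left _ _).trans (le_max_left _ _)
  have hR20 : R2 ≤ R := (le_max_right _ _).trans (le_max_left _ _)
  have hR0 : 0 ≤ R := le_max_right _ _
  have hYp : ∀ x X, R ≤ X - x → 1 ≤ Y (x, X) := by
    intro x X h
    rw [← (hmono x).le_iff_le]
    have := (abs_le.1 (hR1 x)).2
    simp only [hY1]; linarith
  have hYm : ∀ x X, X - x ≤ -R → Y (x, X) ≤ -1 := by
    intro x X h
    rw [← (hmono x).le_iff_le]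
    have := (abs_le.1 (hR2 x)).1
    simp only [hY1]; linarith
  have hYper : ∀ x X, Y (x + 1, X + 1) = Y (x, X) := by
    intro x X
    have := hper (x, Y (x, X))
    simp only [Prod.mk_add_mk, add_zero] at this
    have h2 := hY2 (x + 1) (Y (x, X))
    rw [this] at h2
    simpa [hY1] using h2
  set h : Pl → ℝ := fun w => σ (w.1, Y w) with hh
  have hhc : Continuous h := by
    have := H.smoothS.continuous
    have := hYs.continuous
    fun_prop
  have hhper : ∀ t, Function.Periodic (fun x => h (x, x + t)) 1 := by
    intro t x
    have := hperS (x, Y (x, x + t))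
    simp only [Prod.mk_add_mk, add_zero] at this
    simp only [hh]
    rw [show x + 1 + t = (x + t) + 1 by ring, hYper, this]
  obtain ⟨M, hM⟩ : ∃ M : ℝ, ∀ x t, t ∈ Icc (-R) R → -M ≤ h (x, x + t) := by
    have hcpt : IsCompact (Icc (0:ℝ) 1 ×ˢ Icc (-R) R) := isCompact_Icc.prod isCompact_Icc
    have hc : Continuous (fun u : ℝ × ℝ => h (u.1, u.1 + u.2)) := by fun_prop
    obtain ⟨M, hM⟩ := hcpt.exists_bound_of_continuousOn hc.continuousOn
    refine ⟨M, fun x t ht => ?_⟩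
    obtain ⟨x', hx', e⟩ := (hhper t).exists_mem_Ico₀ one_pos x
    have e' : h (x, x + t) = h (x', x' + t) := e
    rw [e']
    exact (abs_le.1 (hM (x', t) ⟨⟨hx'.1, hx'.2.le⟩, ht⟩)).1
  have hd : ∀ x X, HasDerivAt (fun x => h (x, X)) (-Y (x, X)) x := by
    intro x X
    have a2 : HasDerivAt (fun w : ℝ => ((w, X) : Pl)) (1, 0) x :=
      (hasDerivAt_id x).prodMk (hasDerivAt_const x X)
    have b2 := (hYd (x, X)).comp_hasDerivAt x a2
    refine b2.congr_deriv ?_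
    simp
  have key : ∀ x X, |x - X| - (M + R) ≤ h (x, X) := by
    intro x X
    rcases le_total (x - X) (-R) with h1 | h1
    ·
      have hanti : AntitoneOn (fun s => h (s, X) + s) (Iic (X - R)) := by
        refine antitoneOn_of_hasDerivWithinAt_nonpos (convex_Iic _) ?_
          (fun s _ => (((hd s X).add (hasDerivAt_id s))).hasDerivWithinAt) ?_
        · exact Continuous.continuousOn (by fun_prop)
        · intro s hs
          rw [interior_Iic] at hs
          have := hYp s X (by simp only [mem_Iio] at hs; linarith)
          linarith
      have e := hanti (a := x) (b := X - R) (by simp; linarith) (by simp) (by linarith)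
      have e2 := hM (X - R) R ⟨by linarith, le_rfl⟩
      rw [sub_add_cancel] at e2
      simp only at e
      rw [abs_of_nonpos (by linarith)]
      linarith
    · rcases le_total (x - X) R with h2 | h2
      · have e2 := hM x (X - x) ⟨by linarith, by linarith⟩
        rw [add_sub_cancel] at e2
        have : |x - X| ≤ R := abs_le.2 ⟨h1, h2⟩
        linarith
      · have hmon : MonotoneOn (fun s => h (s, X) - s) (Ici (X + R)) := by
          refine monotoneOn_of_hasDerivWithinAt_nonneg (convex_Ici _) ?_
            (fun s _ => (((hd s X).sub (hasDerivAt_id s))).hasDerivWithinAt) ?_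
          · exact Continuous.continuousOn (by fun_prop)
          · intro s hs
            rw [interior_Ici] at hs
            have := hYm s X (by simp only [mem_Ioi] at hs; linarith)
            linarith
        have e := hmon (a := X + R) (b := x) (by simp) (by simp; linarith) (by linarith)
        have e2 := hM (X + R) (-R) ⟨le_rfl, by linarith⟩
        rw [add_neg_cancel_right] at e2
        simp only at e
        rw [abs_of_nonneg (by linarith)]
        linarith
  refine ⟨M + R, fun z => ?_⟩
  have := key z.1 (G z).1
  simp only [hh] at this
  rwa [show ((z.1, (G z).1) : Pl) = (z.1, (G (z.1, z.2)).1) from rfl, hY2] at this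

/-- The action along `n` iterates. -/
def actS (F : Pl → Pl) (s : Pl → ℝ) (n : ℕ) (z : Pl) : ℝ := ∑ i ∈ Finset.range n, s (F^[i] z)

theorem actS_add (F : Pl → Pl) (s : Pl → ℝ) (m n : ℕ) :
    actS F s (m + n) = fun z => actS F s m z + actS F s n (F^[m] z) := by
  funext z
  simp only [actS, Finset.sum_range_add, ← Function.iterate_add_apply]
  simp only [add_comm]

theorem iter_good {F : Pl → Pl} {s : Pl → ℝ} (H : GoodMap F s) (hC : Coer F s)
    (nc : ∀ p : Pl, ∀ n : ℕ, 1 ≤ n → (fderiv ℝ (F^[n]) p (0, 1)).1 ≠ 0) (n : ℕ) (hn : 1 ≤ n) :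
    GoodMap (F^[n]) (actS F s n) ∧ Coer (F^[n]) (actS F s n) := by
  have h1 : actS F s 1 = s := by funext z; simp [actS]
  induction n, hn using Nat.le_induction with
  | base => rw [h1, Function.iterate_one]; exact ⟨H, hC⟩
  | succ n hn ih =>
    have e : F^[n + 1] = F ∘ F^[n] := Function.iterate_succ' F n
    have := good_comp ih.1 H ih.2 hC (by rw [← e]; exact fun p => nc p _ (by omega))
    rw [actS_add, h1, e]
    exact ⟨this.1, this.2.1⟩

theorem iter_ineq {F : Pl → Pl} {s : Pl → ℝ} (H : GoodMap F s) (hC : Coer F s)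
    (nc : ∀ p : Pl, ∀ n : ℕ, 1 ≤ n → (fderiv ℝ (F^[n]) p (0, 1)).1 ≠ 0) (m n : ℕ) (hm : 1 ≤ m)
    (hn : 1 ≤ n) (z z1 z2 : Pl) (h1 : z1.1 = z.1) (h2 : (F^[m] z1).1 = z2.1)
    (h3 : (F^[n] z2).1 = (F^[m + n] z).1) :
    actS F s (m + n) z ≤ actS F s m z1 + actS F s n z2 := by
  obtain ⟨A1, A2⟩ := iter_good H hC nc m hm
  obtain ⟨B1, B2⟩ := iter_good H hC nc n hn
  have e : F^[m + n] = F^[n] ∘ F^[m] := by rw [add_comm, Function.iterate_add]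
  have := (good_comp A1 B1 A2 B2 (by rw [← e]; exact fun p => nc p _ (by omega))).2.2 z z1 z2
  rw [actS_add]
  exact this h1 h2 (by rw [h3, e]; rfl)

theorem main_aux {F : Pl → Pl} {s : Pl → ℝ} (H : GoodMap F s) (hC : Coer F s)
    (hper : ∀ z, F (z + (1, 0)) = F z + (1, 0)) (hperS : ∀ z, s (z + (1, 0)) = s z)
    (nc : ∀ p : Pl, ∀ n : ℕ, 1 ≤ n → (fderiv ℝ (F^[n]) p (0, 1)).1 ≠ 0)
    (p : ℤ) (q : ℕ) (hq : 1 ≤ q) :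
    ∃ Ψ : ℝ → ℝ, ContDiff ℝ 1 Ψ ∧ (∀ x : ℝ, Ψ (x + 1) = Ψ x) ∧
      {z : Pl | F^[q] z = z + ((p : ℝ), 0)} = {z : Pl | z.2 = Ψ z.1} := by
  have hpn : ∀ n z, F^[n] (z + (1, 0)) = F^[n] z + (1, 0) := by
    intro n
    induction n with
    | zero => intro z; rfl
    | succ n ih => intro z; rw [Function.iterate_succ_apply, hper, ih]; rfl
  have hpa : ∀ n z, actS F s n (z + (1, 0)) = actS F s n z := by
    intro n z
    simp only [actS, hpn, hperS]
  have hpz : ∀ (n : ℕ) (k : ℤ) (z : Pl), F^[n] (z + ((k : ℝ), 0)) = F^[n] z + ((k : ℝ), 0) := by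
    intro n k
    induction k using Int.induction_on with
    | zero =>
      intro z
      have e0 : (((0 : ℤ) : ℝ), (0 : ℝ)) = (0 : Pl) := by simp
      rw [e0, add_zero, add_zero]
    | succ i ih =>
      intro z
      have e : (((i : ℤ) + 1 : ℤ) : ℝ) = ((i : ℤ) : ℝ) + 1 := by push_cast; ring
      have e2 : ∀ w : Pl, w + (((((i : ℤ) + 1 : ℤ) : ℝ)), (0:ℝ)) = w + ((((i : ℤ) : ℝ)), 0) + (1, 0) := by
        intro w; rw [e, add_assoc]; simp
      rw [e2, hpn, ih, e2]
    | pred i ih =>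
      intro z
      have e2 : ∀ w : Pl, w + ((((-(i : ℤ) - 1 : ℤ) : ℝ)), (0:ℝ)) + (1, 0) = w + (((-(i : ℤ) : ℤ) : ℝ), 0) := by
        intro w; rw [add_assoc]; simp
      apply add_right_cancel (b := ((1, 0) : Pl))
      rw [← hpn, e2, ih, e2]
  have hpaz : ∀ (n : ℕ) (k : ℤ) (z : Pl), actS F s n (z + ((k : ℝ), 0)) = actS F s n z := by
    have hs : ∀ (k : ℤ) (z : Pl), s (z + ((k : ℝ), 0)) = s z := by
      intro k z
      have : Function.Periodic s (1, 0) := hperS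
      have := this.zsmul k z
      simpa using this
    intro n k z
    simp only [actS, hpz, hs]
  obtain ⟨Hq, -⟩ := iter_good H hC nc q hq
  obtain ⟨Y, hYs, hY1, hY2, hYd⟩ := good_inverse Hq
  set Ψ : ℝ → ℝ := fun x => Y (x, x + p) with hΨ
  have hΨ1 : ∀ x, (F^[q] (x, Ψ x)).1 = x + p := fun x => hY1 _ _
  have hΨu : ∀ x y, (F^[q] (x, y)).1 = x + p → y = Ψ x := by
    intro x y h
    rw [← hY2 x y, h]
  have hΨp : ∀ x, Ψ (x + 1) = Ψ x := by
    intro x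
    symm
    apply hΨu
    have := hpn q (x, Ψ x)
    simp only [Prod.mk_add_mk, add_zero] at this
    rw [this, Prod.fst_add, hΨ1]
    simp; ring
  set A : ℝ → ℝ := fun x => actS F s q (x, Ψ x) with hA
  have hAd : ∀ x, HasDerivAt A ((F^[q] (x, Ψ x)).2 - Ψ x) x := by
    intro x
    have a2 : HasDerivAt (fun w : ℝ => ((w, w + p) : Pl)) (1, 1) x :=
      (hasDerivAt_id x).prodMk ((hasDerivAt_id x).add_const _)
    have b2 := (hYd (x, x + p)).comp_hasDerivAt x a2
    refine b2.congr_deriv ?_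
    simp [hΨ]; ring
  have hAc : Continuous A := continuous_iff_continuousAt.2 fun x => (hAd x).continuousAt
  have hAp : Function.Periodic A 1 := by
    intro x
    have := hpa q (x, Ψ x)
    simp only [Prod.mk_add_mk, add_zero] at this
    simp only [hA, hΨp, this]
  obtain ⟨a, ha⟩ : ∃ a, ∀ x, A x ≤ A a := by
    obtain ⟨a, -, ha⟩ := isCompact_Icc.exists_isMaxOn (s := Icc (0:ℝ) 1) ⟨0, by simp⟩
      hAc.continuousOn
    refine ⟨a, fun x => ?_⟩
    obtain ⟨x', hx', e⟩ := hAp.exists_mem_Ico₀ one_pos x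
    rw [e]
    exact ha ⟨hx'.1, hx'.2.le⟩
  have hcrit : (F^[q] (a, Ψ a)).2 - Ψ a = 0 :=
    IsLocalMax.hasDerivAt_eq_zero (Filter.Eventually.of_forall ha) (hAd a)
  have hFa : F^[q] (a, Ψ a) = (a, Ψ a) + ((p : ℝ), 0) :=
    Prod.ext (hΨ1 a) (by simpa using sub_eq_zero.1 hcrit)
  have hFm : ∀ m : ℕ, F^[m * q] (a, Ψ a) = (a, Ψ a) + (((m * p : ℤ) : ℝ), 0) ∧
      actS F s (m * q) (a, Ψ a) = m * A a := by
    intro m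
    induction m with
    | zero => simp [actS]
    | succ m ih =>
      have e : (m + 1) * q = m * q + q := by ring
      constructor
      · rw [e, add_comm, Function.iterate_add_apply, ih.1, hpz, hFa, add_assoc]
        congr 1
        simp; ring
      · rw [e, actS_add]
        simp only [ih.1, ih.2, hpaz]
        push_cast; simp only [hA]; ring
  have hle : ∀ b, A a ≤ A b := by
    intro b
    obtain ⟨y1, hy1⟩ := Hq.surj a (b + p)
    obtain ⟨y2, hy2⟩ := Hq.surj b (a + p)
    have step : ∀ m : ℕ, ∃ y, (F^[(m + 1) * q] (a, y)).1 = b + ((m + 1) * p : ℤ) ∧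
        actS F s ((m + 1) * q) (a, y) ≤ actS F s q (a, y1) + m * A b := by
      intro m
      induction m with
      | zero => exact ⟨y1, by simpa using hy1, by simp⟩
      | succ m ih =>
        obtain ⟨y, e1, e2⟩ := ih
        have hpos : 1 ≤ (m + 1) * q := Nat.mul_pos (by omega) hq
        have e : (m + 1 + 1) * q = (m + 1) * q + q := by ring
        obtain ⟨y', hy'⟩ := (iter_good H hC nc ((m + 1) * q + q) (by omega)).1.surj a
          (b + ((m + 1 + 1) * p : ℤ))
        refine ⟨y', by rw [e, hy']; push_cast; ring, ?_⟩
        have := iter_ineq H hC nc ((m + 1) * q) q hpos hq (a, y') (a, y)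
          ((b, Ψ b) + ((((m + 1) * p : ℤ) : ℝ), 0)) rfl (by rw [e1]; simp)
          (by rw [hy', hpz, Prod.fst_add, hΨ1]; push_cast; ring)
        rw [hpaz] at this
        rw [e]
        push_cast
        simp only [hA] at *
        linarith
    have bound : ∀ m : ℕ, m * (A a - A b) ≤ actS F s q (a, y1) + actS F s q (b, y2) - 2 * A a := by
      intro m
      obtain ⟨y, e1, e2⟩ := step m
      have hpos : 1 ≤ (m + 1) * q := Nat.mul_pos (by omega) hq
      have e : (m + 2) * q = (m + 1) * q + q := by ring
      have h2 := hFm (m + 2)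
      have := iter_ineq H hC nc ((m + 1) * q) q hpos hq (a, Ψ a) (a, y)
          ((b, y2) + ((((m + 1) * p : ℤ) : ℝ), 0)) rfl (by rw [e1]; simp)
          (by rw [← e, h2.1, hpz, Prod.fst_add, hy2]; push_cast; simp; ring)
      rw [hpaz, ← e, h2.2] at this
      push_cast at this
      linarith
    by_contra hlt
    push Not at hlt
    obtain ⟨m, hm⟩ := Archimedean.arch
      (actS F s q (a, y1) + actS F s q (b, y2) - 2 * A a + 1) (sub_pos.2 hlt)
    have := bound m
    rw [nsmul_eq_mul] at hm
    linarith
  have hconst : ∀ x, A x = A a := fun x => le_antisymm (ha x) (hle x)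
  have hzero : ∀ x, (F^[q] (x, Ψ x)).2 = Ψ x := by
    intro x
    have h0 : HasDerivAt A 0 x := by
      have : A = fun _ => A a := funext hconst
      rw [this]; exact hasDerivAt_const _ _
    exact sub_eq_zero.1 ((hAd x).unique h0)
  refine ⟨Ψ, hYs.comp (contDiff_id.prodMk (contDiff_id.add contDiff_const)), hΨp, ?_⟩
  ext ⟨x, y⟩
  simp only [mem_ofPred_eq]
  constructor
  · intro h
    exact hΨu x y (by rw [h]; rfl)
  · rintro rfl
    exact Prod.ext (hΨ1 x) (by simpa using hzero x)

/-- For an exact symplectic positive twist map with no conjugate points and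
lift `F`, for every `p ∈ ℤ`, `q ∈ ℕ*`, the set `{z : F^q(z) = z + (p,0)}` is nonempty and is
the graph of a `1`-periodic `C¹` function `Ψ_{p/q} : ℝ → ℝ`. -/
theorem statement13 (S : IsotopySetup) (htwist : S.PosTwist)
    (hexact : S.ExactSymplectic) (hnc : S.NoConjPts)
    (p : ℤ) (q : ℕ) (hq : 1 ≤ q) :
    ({z : Pl | S.F^[q] z = z + ((p : ℝ), 0)}).Nonempty ∧
    ∃ Ψ : ℝ → ℝ, ContDiff ℝ 1 Ψ ∧ (∀ x : ℝ, Ψ (x + 1) = Ψ x) ∧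
      {z : Pl | S.F^[q] z = z + ((p : ℝ), 0)} = {z : Pl | z.2 = Ψ z.1} := by
  obtain ⟨-, s, hs, hsp, hse⟩ := hexact
  have hsm : ContDiff ℝ 1 S.F := S.Ft_smooth 1 (by simp)
  have hper : ∀ z, S.F (z + (1, 0)) = S.F z + (1, 0) := S.Ft_periodic 1
  have H : GoodMap S.F s := by
    refine ⟨hsm, hs, ?_, fun z => by simpa using hnc z 1 le_rfl, fun x X => (htwist x).2.1 X⟩
    rintro z ⟨v1, v2⟩
    obtain ⟨e1, e2⟩ := hse z
    have hv : ((v1, v2) : Pl) = v1 • ((1, 0) : Pl) + v2 • ((0, 1) : Pl) := by simp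
    rw [hv, map_add, map_add, map_smul, map_smul, map_smul, map_smul, e1, e2]
    simp only [Prod.fst_add, Prod.smul_fst, smul_eq_mul]
    ring
  have hC := base_coer H hper hsp (fun x => (htwist x).1)
  obtain ⟨Ψ, h1, h2, h3⟩ := main_aux H hC hper hsp hnc p q hq
  refine ⟨?_, Ψ, h1, h2, h3⟩
  rw [h3]
  exact ⟨(0, Ψ 0), rfl⟩

end
end

section
/- Let f : 𝔸 → 𝔸 be an exact symplectic positive twist map with no conjugate points, and let F be a lift of f. For rationals ρ = p/q and ρ' = p'/q' (p, p' ∈ ℤ, q, q' ∈ ℕ*), let Ψ_ρ and Ψ_{ρ'} be the 1-periodic functions whose graphs are {z : F^q(z) = z + (p,0)} and {z : F^{q'}(z) = z + (p',0)} respectively. If ρ < ρ', then Ψ_ρ(x) < Ψ_{ρ'}(x) for every x ∈ ℝ. -/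
noncomputable section

open MeasureTheory Set Filter Topology Function

/-- Bounded second coordinate on horizontal strips. -/
lemma aux_bdd (G : Pl → Pl) (hG : Continuous G)
    (hper : ∀ z : Pl, G (z + (1, 0)) = G z + (1, 0)) (M : ℝ) :
    ∃ K, ∀ z : Pl, |z.2| ≤ M → |(G z).2| ≤ K := by
  have hc : IsCompact (Icc (0:ℝ) 1 ×ˢ Icc (-M) M) := isCompact_Icc.prod isCompact_Icc
  obtain ⟨K, hK⟩ := hc.exists_bound_of_continuousOn (f := fun z : Pl => (G z).2)
    (by fun_prop)
  refine ⟨K, ?_⟩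
  rintro ⟨x, y⟩ hy
  have hp : Function.Periodic (fun x : ℝ => (G (x, y)).2) 1 := by
    intro x
    have := hper (x, y)
    simp at this
    simp [this]
  obtain ⟨x', hx', he⟩ := hp.exists_mem_Ico₀ one_pos x
  have := hK (x', y) ⟨⟨hx'.1, hx'.2.le⟩, abs_le.1 hy⟩
  simp only [Real.norm_eq_abs] at this he
  rw [he]; exact this

/-- Uniform displacement to the right for large heights. -/
lemma aux_right (F : Pl → Pl) (hF : Continuous F)
    (hper : ∀ z : Pl, F (z + (1, 0)) = F z + (1, 0))
    (hmono : ∀ x : ℝ, StrictMono (fun y => (F (x, y)).1))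
    (hsurj : ∀ x : ℝ, Function.Surjective (fun y => (F (x, y)).1)) :
    ∃ K, ∀ z : Pl, K < z.2 → z.1 ≤ (F z).1 := by
  have key : ∃ K, ∀ x ∈ Icc (0:ℝ) 1, ∀ y, K < y → x ≤ (F (x, y)).1 := by
    refine (isCompact_Icc (a := (0:ℝ)) (b := 1)).induction_on
      (p := fun s => ∃ K, ∀ x ∈ s, ∀ y, K < y → x ≤ (F (x, y)).1) ?_ ?_ ?_ ?_
    · exact ⟨0, by simp⟩
    · rintro s t hst ⟨K, hK⟩
      exact ⟨K, fun x hx => hK x (hst hx)⟩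
    · rintro s t ⟨K, hK⟩ ⟨L, hL⟩
      refine ⟨max K L, ?_⟩
      rintro x (hx | hx) y hy
      · exact hK x hx y ((le_max_left _ _).trans_lt hy)
      · exact hL x hx y ((le_max_right _ _).trans_lt hy)
    · intro x _
      obtain ⟨y, hy⟩ := hsurj x (x + 1)
      have ho : IsOpen {u : ℝ | u < (F (u, y)).1} :=
        isOpen_lt continuous_id (by fun_prop)
      have hm : x ∈ {u : ℝ | u < (F (u, y)).1} := by
        simp only [mem_ofPred_eq]; simp only at hy; rw [hy]; linarith
      refine ⟨_, mem_nhdsWithin_of_mem_nhds (ho.mem_nhds hm), y, ?_⟩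
      intro u hu v hv
      exact (le_of_lt hu).trans (hmono u hv).le
  obtain ⟨K, hK⟩ := key
  refine ⟨K, ?_⟩
  rintro ⟨x, y⟩ hy
  have hp : Function.Periodic (fun x : ℝ => (F (x, y)).1 - x) 1 := by
    intro x
    have := hper (x, y)
    simp at this
    simp [this]
  obtain ⟨x', hx', he⟩ := hp.exists_mem_Ico₀ one_pos x
  have := hK x' ⟨hx'.1, hx'.2.le⟩ y hy
  simp only at he ⊢
  linarith

/-- The upper end is preserved. -/
lemma aux_end (F G : Pl → Pl) (hF : Continuous F) (hG : Continuous G)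
    (hGF : Function.LeftInverse G F) (hFG : Function.RightInverse G F)
    (hper : ∀ z : Pl, F (z + (1, 0)) = F z + (1, 0))
    (hmono : ∀ x : ℝ, StrictMono (fun y => (F (x, y)).1))
    (hsurj : ∀ x : ℝ, Function.Surjective (fun y => (F (x, y)).1))
    (hanti : StrictAnti (fun Y => (G (0, Y)).1)) (M : ℝ) :
    ∃ K, ∀ z : Pl, K < z.2 → M < (F z).2 := by
  have hGper : ∀ z : Pl, G (z + (1, 0)) = G z + (1, 0) := by
    intro z
    apply hGF.injective
    rw [hper, hFG, hFG]
  choose yk hyk using hsurj 0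
  simp only at hyk
  have hykmono : StrictMono yk := by
    intro a b hab
    by_contra h
    have := (hmono 0).monotone (not_lt.1 h)
    simp only [hyk] at this
    linarith
  -- points
  have hpt : ∀ k : ℕ, (F (-(k:ℝ), yk k)).1 = 0 := by
    intro k
    have hp : Function.Periodic (fun x : ℝ => (F (x, yk k)).1 - x) 1 := by
      intro x
      have := hper (x, yk k)
      simp at this
      simp [this]
    have := hp.nat_mul k (-(k:ℝ))
    simp [hyk] at this
    linarith
  have hY : ∀ k : ℕ, 1 ≤ k → (F (0, yk 0)).2 < (F (-(k:ℝ), yk k)).2 := by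
    intro k hk
    by_contra h
    have h2 := hanti.antitone (not_lt.1 h)
    have e1 : ((0:ℝ), (F (0, yk 0)).2) = F (0, yk 0) := by
      ext
      · simp [hyk]
      · rfl
    have e2 : ((0:ℝ), (F (-(k:ℝ), yk k)).2) = F (-(k:ℝ), yk k) := by
      ext
      · simp [hpt]
      · rfl
    simp only [e1, e2, hGF _] at h2
    have : (1:ℝ) ≤ k := by exact_mod_cast hk
    linarith
  set Y0 := (F (0, yk 0)).2 with hY0
  set M1 := max |M| |Y0| with hM1
  obtain ⟨K, hK⟩ := aux_bdd G hG hGper M1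
  have hout : ∀ z : Pl, K < z.2 → M1 < |(F z).2| := by
    intro z hz
    by_contra h
    have := hK (F z) (not_lt.1 h)
    rw [hGF z] at this
    exact absurd (le_abs_self z.2) (by linarith)
  have hM1n : 0 ≤ M1 := (abs_nonneg M).trans (le_max_left _ _)
  have hpre : IsPreconnected {z : Pl | K < z.2} :=
    ((convex_Ioi K).is_linear_preimage (IsLinearMap.mk (f := fun z : Pl => z.2)
      (fun _ _ => rfl) (fun _ _ => rfl))).isPreconnected
  -- a point of the region with positive image height
  obtain ⟨k, hk1, hkK⟩ : ∃ k : ℕ, 1 ≤ k ∧ K < yk k := by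
    obtain ⟨k, hk⟩ := exists_nat_gt (max 1 (F (0, K)).1)
    refine ⟨k, ?_, ?_⟩
    · have := (le_max_left _ _).trans hk.le
      exact_mod_cast this
    · by_contra h
      have h1 := (hmono 0).monotone (not_lt.1 h)
      simp only [hyk] at h1
      have := (le_max_right 1 (F (0, K)).1).trans_lt hk
      linarith
  refine ⟨K, fun z hz => ?_⟩
  have hpos : 0 < (F (-(k:ℝ), yk k)).2 := by
    have h1 := hout (-(k:ℝ), yk k) hkK
    have h2 := hY k hk1
    have h3 : |Y0| ≤ M1 := le_max_right _ _
    have h4 := neg_abs_le Y0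
    by_contra h
    rw [abs_of_nonpos (not_lt.1 h)] at h1
    linarith
  have hzpos : 0 < (F z).2 := by
    by_contra h
    have := hpre.intermediate_value (f := fun z : Pl => (F z).2) hz
      (show (-(k:ℝ), yk k) ∈ {z : Pl | K < z.2} from hkK) (by fun_prop)
    obtain ⟨w, hw, hw0⟩ := this ⟨not_lt.1 h, hpos.le⟩
    have := hout w hw
    simp only at hw0
    rw [hw0, abs_zero] at this
    linarith
  have h1 := hout z hz
  rw [abs_of_pos hzpos] at h1
  have h3 : |M| ≤ M1 := le_max_left _ _
  have := le_abs_self M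
  linarith

/-- Determinant of a linear map of the plane. -/
def dt (A : Pl →L[ℝ] Pl) : ℝ := (A (1, 0)).1 * (A (0, 1)).2 - (A (0, 1)).1 * (A (1, 0)).2

lemma dt_split (A : Pl →L[ℝ] Pl) (u v : ℝ) : A (u, v) = u • A (1, 0) + v • A (0, 1) := by
  rw [← map_smul, ← map_smul, ← map_add]; simp

lemma dt_ne (A B : Pl →L[ℝ] Pl) (h : ∀ w, A (B w) = w) : dt A ≠ 0 := by
  intro h0
  have e1 := h (1, 0)
  have e2 := h (0, 1)
  rcases hb1 : B (1, 0) with ⟨b11, b21⟩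
  rcases hb2 : B (0, 1) with ⟨b12, b22⟩
  rw [hb1, dt_split] at e1
  rw [hb2, dt_split] at e2
  unfold dt at h0
  simp only [Prod.ext_iff, Prod.fst_add, Prod.snd_add, Prod.smul_fst, Prod.smul_snd,
    smul_eq_mul] at e1 e2
  obtain ⟨e11, e12⟩ := e1
  obtain ⟨e21, e22⟩ := e2
  have : ((A (1, 0)).1 * (A (0, 1)).2 - (A (0, 1)).1 * (A (1, 0)).2) * (b11 * b22 - b12 * b21)
      = 1 := by
    linear_combination (b12 * (A (1, 0)).2 + b22 * (A (0, 1)).2) * e11 + e22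
      - (b12 * (A (1, 0)).1 + b22 * (A (0, 1)).1) * e12
  rw [h0] at this
  simp at this

lemma fderiv_rinv_pl (F G : Pl → Pl) (hF : ContDiff ℝ 1 F) (hG : ContDiff ℝ 1 G)
    (hFG : Function.RightInverse G F) (z : Pl) (w : Pl) :
    fderiv ℝ F (G z) (fderiv ℝ G z w) = w := by
  have h1 : F ∘ G = id := funext hFG
  have h2 := fderiv_comp z (hF.differentiable one_ne_zero (G z))
    (hG.differentiable one_ne_zero z)
  rw [h1, fderiv_id] at h2
  exact (DFunLike.congr_fun h2 w).symm

namespace IsotopySetup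

lemma dt_pos (S : IsotopySetup) (z : Pl) : 0 < dt (fderiv ℝ S.F z) := by
  have hc : ContinuousOn (fun t => fderiv ℝ (S.Ft t) z) (Icc (0:ℝ) 1) :=
    S.DFt_cont.comp (f := fun t : ℝ => (t, z)) (by fun_prop) (fun t ht => ⟨ht, mem_univ _⟩)
  have hd : ContinuousOn (fun t => dt (fderiv ℝ (S.Ft t) z)) (Icc (0:ℝ) 1) := by
    unfold dt
    fun_prop
  have h0 : dt (fderiv ℝ (S.Ft 0) z) = 1 := by
    rw [S.Ft_zero, fderiv_id]; simp [dt]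
  have hne : ∀ t ∈ Icc (0:ℝ) 1, dt (fderiv ℝ (S.Ft t) z) ≠ 0 := by
    intro t ht
    obtain ⟨G, hG, hl, hr⟩ := S.Ft_diffeo t ht
    have := fderiv_rinv_pl (S.Ft t) G (S.Ft_smooth t ht) hG hr (S.Ft t z)
    rw [hl z] at this
    exact dt_ne _ _ this
  by_contra h
  obtain ⟨t, ht, ht0⟩ := intermediate_value_Icc' (zero_le_one' ℝ) hd
    (show (0:ℝ) ∈ _ from ⟨not_lt.1 h, by rw [h0]; exact zero_le_one⟩)
  exact hne t ht ht0

end IsotopySetup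

/-- Derivative along vertical lines. -/
lemma vert_deriv (H : Pl → Pl) (hH : ContDiff ℝ 1 H) (x y : ℝ) :
    HasDerivAt (fun y => (H (x, y)).1) ((fderiv ℝ H (x, y)) (0, 1)).1 y := by
  have h1 : HasDerivAt (fun y : ℝ => ((x, y) : Pl)) (0, 1) y :=
    (hasDerivAt_const y x).prodMk (hasDerivAt_id y)
  have h2 := (hH.differentiable one_ne_zero (x, y)).hasFDerivAt.comp_hasDerivAt y h1
  exact hasFDerivAt_fst.comp_hasDerivAt y h2

lemma vert_inj_s14 (H : Pl → Pl) (hH : ContDiff ℝ 1 H) (x : ℝ)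
    (h : ∀ y, ((fderiv ℝ H (x, y)) (0, 1)).1 ≠ 0) :
    Function.Injective (fun y => (H (x, y)).1) := by
  have key : ∀ a b : ℝ, a < b → (H (x, a)).1 ≠ (H (x, b)).1 := by
    intro a b hab he
    obtain ⟨c, _, hc⟩ := exists_hasDerivAt_eq_zero (f := fun y => (H (x, y)).1) hab
      (by have := hH.continuous; fun_prop) he (fun y _ => vert_deriv H hH x y)
    exact h c hc
  intro a b hab
  rcases lt_trichotomy a b with h1 | h1 | h1
  · exact absurd hab (key a b h1)
  · exact h1
  · exact absurd hab.symm (key b a h1)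

/-- For an exact symplectic positive twist map with no conjugate points:
if `ρ = p/q < ρ' = p'/q'` are rationals and `Ψ`, `Ψ'` are the `1`-periodic functions whose
graphs are `{z : F^q(z) = z + (p,0)}` and `{z : F^{q'}(z) = z + (p',0)}`, then `Ψ < Ψ'`
everywhere. -/
theorem statement14 (S : IsotopySetup) (htwist : S.PosTwist)
    (hexact : S.ExactSymplectic) (hnc : S.NoConjPts)
    (p p' : ℤ) (q q' : ℕ) (hq : 1 ≤ q) (hq' : 1 ≤ q')
    (Ψ Ψ' : ℝ → ℝ)
    (hΨper : ∀ x : ℝ, Ψ (x + 1) = Ψ x) (hΨ'per : ∀ x : ℝ, Ψ' (x + 1) = Ψ' x)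
    (hΨ : ∀ z : Pl, S.F^[q] z = z + ((p : ℝ), 0) ↔ z.2 = Ψ z.1)
    (hΨ' : ∀ z : Pl, S.F^[q'] z = z + ((p' : ℝ), 0) ↔ z.2 = Ψ' z.1)
    (hρ : (p : ℝ) / q < (p' : ℝ) / q') :
    ∀ x : ℝ, Ψ x < Ψ' x := by
  have h1mem : (1:ℝ) ∈ Icc (0:ℝ) 1 := ⟨zero_le_one, le_rfl⟩
  obtain ⟨G, hG, hGF, hFG⟩ := S.Ft_diffeo 1 h1mem
  have hFs : ContDiff ℝ 1 S.F := S.Ft_smooth 1 h1mem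
  change Function.LeftInverse G S.F at hGF
  change Function.RightInverse G S.F at hFG
  have hper : ∀ z : Pl, S.F (z + (1, 0)) = S.F z + (1, 0) := S.Ft_periodic 1
  have hmono := fun x => (htwist x).1
  have hsurj := fun x => (htwist x).2.1
  have hanti : StrictAnti (fun Y => (G (0, Y)).1) := by
    have hinj : Function.Injective (fun Y => (G (0, Y)).1) := by
      intro a b hab
      simp only at hab
      have ha := hFG (0, a)
      have hb := hFG (0, b)
      have h3 : (S.F ((G (0, a)).1, (G (0, a)).2)).1 = (S.F ((G (0, a)).1, (G (0, b)).2)).1 := by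
        rw [hab, Prod.mk.eta, hb, ← hab, Prod.mk.eta, ha]
      have h4 := (hmono _).injective h3
      have h5 : G (0, a) = G (0, b) := Prod.ext hab h4
      rw [h5, hb] at ha
      exact (congrArg Prod.snd ha).symm
    have hcont : Continuous (fun Y => (G (0, Y)).1) := by
      have := hG.continuous; fun_prop
    rcases hcont.strictMono_of_inj hinj with hm | ha
    · exfalso
      have hd := vert_deriv G hG 0 0
      have hnn : 0 ≤ ((fderiv ℝ G (0, 0)) (0, 1)).1 := by
        rw [← hd.deriv]; exact hm.monotone.deriv_nonneg
      have hi := fderiv_rinv_pl S.F G hFs hG hFG (0, 0) (0, 1)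
      have hdt := S.dt_pos (G (0, 0))
      have hb : 0 < ((fderiv ℝ S.F (G (0, 0))) (0, 1)).1 := by
        have h6 := (htwist (G (0, 0)).1).2.2 (G (0, 0)).2
        rw [(vert_deriv S.F hFs _ _).deriv] at h6
        exact h6
      rcases huv : (fderiv ℝ G (0, 0)) (0, 1) with ⟨u, v⟩
      rw [huv, dt_split] at hi
      rw [huv] at hnn
      unfold dt at hdt
      simp only [Prod.ext_iff, Prod.fst_add, Prod.snd_add, Prod.smul_fst, Prod.smul_snd,
        smul_eq_mul] at hi hnn
      obtain ⟨e1, e2⟩ := hi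
      generalize ((fderiv ℝ S.F (G (0, 0))) (0, 1)).1 = b at *
      generalize ((fderiv ℝ S.F (G (0, 0))) (0, 1)).2 = d at *
      generalize ((fderiv ℝ S.F (G (0, 0))) (1, 0)).1 = a at *
      generalize ((fderiv ℝ S.F (G (0, 0))) (1, 0)).2 = c at *
      have h7 : b = -(u * (a * d - b * c)) := by
        linear_combination (-b) * e2 + d * e1
      have h8 := mul_nonneg hnn hdt.le
      linarith
    · exact ha
  have hend := aux_end S.F G hFs.continuous hG.continuous hGF hFG hper hmono hsurj hanti
  obtain ⟨K0, hK0⟩ := aux_right S.F hFs.continuous hper hmono hsurj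
  have hQ : ∀ n : ℕ, ∃ K, ∀ z : Pl, K < z.2 → z.1 ≤ (S.F^[n] z).1 := by
    intro n
    induction n with
    | zero => exact ⟨0, fun z _ => le_rfl⟩
    | succ n ih =>
      obtain ⟨K, hK⟩ := ih
      obtain ⟨L, hL⟩ := hend K
      refine ⟨max L K0, fun z hz => ?_⟩
      rw [Function.iterate_succ_apply]
      exact (hK0 z ((le_max_right _ _).trans_lt hz)).trans
        (hK _ (hL z ((le_max_left _ _).trans_lt hz)))
  have hQ' : ∀ n : ℕ, ∃ K, ∀ z : Pl, K < z.2 → (S.F z).1 ≤ (S.F^[n + 1] z).1 := by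
    intro n
    obtain ⟨K, hK⟩ := hQ n
    obtain ⟨L, hL⟩ := hend K
    refine ⟨L, fun z hz => ?_⟩
    rw [Function.iterate_succ_apply]
    exact hK _ (hL z hz)
  have hit : ∀ n : ℕ, ContDiff ℝ 1 (S.F^[n]) := by
    intro n
    induction n with
    | zero => exact contDiff_id
    | succ n ih => rw [Function.iterate_succ]; exact ih.comp hFs
  have hinc : ∀ n : ℕ, ∀ x : ℝ, StrictMono (fun y => (S.F^[n + 1] (x, y)).1) := by
    intro n x
    have hinj := vert_inj_s14 (S.F^[n + 1]) (hit _) x (fun y => hnc (x, y) (n + 1) (by omega))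
    have hcont : Continuous (fun y => (S.F^[n + 1] (x, y)).1) := by
      have := (hit (n + 1)).continuous; fun_prop
    rcases hcont.strictMono_of_inj hinj with hm | ha
    · exact hm
    · exfalso
      obtain ⟨K, hK⟩ := hQ' n
      obtain ⟨y, hy⟩ := hsurj x ((S.F^[n + 1] (x, 0)).1 + 1)
      simp only at hy
      have hw1 : K < max (max (K + 1) 0) y :=
        lt_of_lt_of_le (by linarith) ((le_max_left (K + 1) 0).trans (le_max_left _ y))
      have hw2 : 0 ≤ max (max (K + 1) 0) y := (le_max_right (K + 1) 0).trans (le_max_left _ y)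
      have hw3 : y ≤ max (max (K + 1) 0) y := le_max_right _ _
      generalize max (max (K + 1) 0) y = w at *
      have h1 := hK (x, w) hw1
      have h2 := ha.antitone hw2
      have h3 := (hmono x).monotone hw3
      linarith
  -- periodic points
  have hshift : ∀ (k : ℤ) (z : Pl), S.F (z + ((k:ℝ), 0)) = S.F z + ((k:ℝ), 0) := by
    rintro k ⟨x, y⟩
    have hp : Function.Periodic (fun x : ℝ => S.F (x, y) - (x, 0)) 1 := by
      intro x
      have := hper (x, y)
      simp only [Prod.mk_add_mk, add_zero] at this
      ext <;> simp [this]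
    have h1 := hp.int_mul k x
    simp only [mul_one] at h1
    have h2 : ((x, y) : Pl) + ((k:ℝ), 0) = (x + k, y) := by simp
    rw [h2, sub_eq_iff_eq_add.1 h1]
    ext <;> simp
    ring
  have hshiftn : ∀ (n : ℕ) (k : ℤ) (z : Pl),
      S.F^[n] (z + ((k:ℝ), 0)) = S.F^[n] z + ((k:ℝ), 0) := by
    intro n k
    induction n with
    | zero => intro z; rfl
    | succ n ih => intro z; rw [Function.iterate_succ_apply, hshift, ih, Function.iterate_succ_apply]
  have hmul : ∀ (m : ℕ) (k : ℤ) (z : Pl), S.F^[m] z = z + ((k:ℝ), 0) →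
      ∀ n : ℕ, (S.F^[m * n] z).1 = z.1 + n * k := by
    intro m k z hz n
    have : S.F^[m * n] z = z + (((n * k : ℤ) : ℝ), 0) := by
      induction n with
      | zero => simp
      | succ n ih =>
        rw [Nat.mul_succ, Function.iterate_add_apply, hz, hshiftn, ih]
        ext <;> simp
        ring
    rw [this]; simp
  intro x
  have hz := hmul q p (x, Ψ x) ((hΨ _).2 rfl) q'
  have hz' := hmul q' p' (x, Ψ' x) ((hΨ' _).2 rfl) q
  rw [mul_comm q' q] at hz'
  obtain ⟨n, hn⟩ : ∃ n, q * q' = n + 1 := ⟨q * q' - 1, by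
    have := Nat.mul_pos hq hq'; omega⟩
  rw [hn] at hz hz'
  have hqr : (0:ℝ) < q := by exact_mod_cast hq
  have hqr' : (0:ℝ) < q' := by exact_mod_cast hq'
  rw [div_lt_div_iff₀ hqr hqr'] at hρ
  refine (hinc n x).lt_iff_lt.1 ?_
  change (S.F^[n + 1] (x, Ψ x)).1 < (S.F^[n + 1] (x, Ψ' x)).1
  rw [hz, hz']
  simp only
  nlinarith

end
end

section
/- Let f : 𝔸 → 𝔸 be a C¹ diffeomorphism isotopic to the identity. Then for every z ∈ 𝔸, every n ∈ ℕ*, and all nonzero tangent vectors w, w' ∈ T_z𝔸 ≅ ℝ², one has −1/2 < n·Torsionₙ(f,z,w) − n·Torsionₙ(f,z,w') < 1/2. -/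
noncomputable section

open MeasureTheory Set Filter Topology Function

theorem aux_noninteger (g : ℝ → ℝ) (N : ℝ) (hN : 0 ≤ N) (hg : ContinuousOn g (Icc 0 N))
    (h : ∀ t ∈ Icc (0:ℝ) N, ∀ k : ℤ, g t ≠ k) : -1 < g N - g 0 ∧ g N - g 0 < 1 := by
  have h1 := Int.floor_le (g 0)
  have h2 := Int.lt_floor_add_one (g 0)
  have h3 : g N < ⌊g 0⌋ + 1 := by
    by_contra hc
    push Not at hc
    obtain ⟨t, ht, hgt⟩ := intermediate_value_Icc hN hg (show ((⌊g 0⌋ : ℝ) + 1) ∈ Icc (g 0) (g N) from ⟨h2.le, hc⟩)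
    exact h t ht (⌊g 0⌋ + 1) (by rw [hgt]; push_cast; rfl)
  have h4 : (⌊g 0⌋ : ℝ) < g N := by
    by_contra hc
    push Not at hc
    obtain ⟨t, ht, hgt⟩ := intermediate_value_Icc' hN hg (show (⌊g 0⌋ : ℝ) ∈ Icc (g N) (g 0) from ⟨hc, h1⟩)
    exact h t ht _ hgt
  constructor <;> linarith

theorem aux_integer (g : ℝ → ℝ) (N : ℝ) (hN : 0 ≤ N) (hg : ContinuousOn g (Icc 0 N))
    (h : ∀ t ∈ Icc (0:ℝ) N, ∃ k : ℤ, g t = k) : -1 < g N - g 0 ∧ g N - g 0 < 1 := by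
  obtain ⟨k, hk⟩ := h 0 ⟨le_rfl, hN⟩
  constructor
  · by_contra hc
    push Not at hc
    obtain ⟨t, ht, hgt⟩ := intermediate_value_Icc' hN hg
      (show ((k : ℝ) - 1/2) ∈ Icc (g N) (g 0) from ⟨by linarith, by linarith⟩)
    obtain ⟨m, hm⟩ := h t ht
    have : (2 * m : ℝ) = 2 * k - 1 := by linarith
    have : 2 * m = 2 * k - 1 := by exact_mod_cast this
    omega
  · by_contra hc
    push Not at hc
    obtain ⟨t, ht, hgt⟩ := intermediate_value_Icc hN hg
      (show ((k : ℝ) + 1/2) ∈ Icc (g 0) (g N) from ⟨by linarith, by linarith⟩)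
    obtain ⟨m, hm⟩ := h t ht
    have : (2 * m : ℝ) = 2 * k + 1 := by linarith
    have : 2 * m = 2 * k + 1 := by exact_mod_cast this
    omega

theorem aux_fderiv_inj (H G : Pl → Pl) (hH : ContDiff ℝ 1 H) (hG : ContDiff ℝ 1 G)
    (hl : Function.LeftInverse G H) (p : Pl) : Function.Injective (fderiv ℝ H p) := by
  have hc : (fderiv ℝ G (H p)).comp (fderiv ℝ H p) = ContinuousLinearMap.id ℝ Pl := by
    rw [← fderiv_comp p ((hG.differentiable one_ne_zero) _) ((hH.differentiable one_ne_zero) _),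
      hl.comp_eq_id, fderiv_id]
  intro x y hxy
  have h1 := DFunLike.congr_fun hc x
  have h2 := DFunLike.congr_fun hc y
  simp only [ContinuousLinearMap.comp_apply, ContinuousLinearMap.id_apply] at h1 h2
  rw [← h1, ← h2, hxy]

theorem aux_iter (H : Pl → Pl) (hH : ContDiff ℝ 1 H) (k : ℕ) : ContDiff ℝ 1 (H^[k]) := by
  induction k with
  | zero => exact contDiff_id
  | succ k ih => rw [Function.iterate_succ]; exact ih.comp hH

theorem aux_D_inj (S : IsotopySetup) (p : Pl) (t : ℝ) : Function.Injective (S.D t p) := by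
  unfold IsotopySetup.D
  rw [ContinuousLinearMap.coe_comp]
  have h1 : Int.fract t ∈ Icc (0:ℝ) 1 := ⟨Int.fract_nonneg t, (Int.fract_lt_one t).le⟩
  have h2 : (1:ℝ) ∈ Icc (0:ℝ) 1 := ⟨zero_le_one, le_rfl⟩
  obtain ⟨G, hG, hGl, -⟩ := S.Ft_diffeo _ h1
  obtain ⟨K, hK, hKl, -⟩ := S.Ft_diffeo _ h2
  exact (aux_fderiv_inj _ G (S.Ft_smooth _ h1) hG hGl _).comp
    (aux_fderiv_inj _ (K^[⌊t⌋₊]) (aux_iter _ (S.Ft_smooth _ h2) _) (aux_iter _ hK _)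
      (hKl.iterate _) _)

def crossPl (u v : Pl) : ℝ := u.1 * v.2 - u.2 * v.1

theorem aux_cross (L : Pl →L[ℝ] Pl) (w w' : Pl) (hw : w ≠ 0)
    (h : crossPl w w' = 0) : crossPl (L w) (L w') = 0 := by
  have e1 : w'.1 • w = w.1 • w' := by
    unfold crossPl at h
    ext <;> simp <;> linarith
  have e2 : w'.2 • w = w.2 • w' := by
    unfold crossPl at h
    ext <;> simp <;> linarith
  have f1 := congrArg L e1
  have f2 := congrArg L e2
  rw [map_smul, map_smul] at f1 f2
  have g11 := congrArg Prod.fst f1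
  have g12 := congrArg Prod.snd f1
  have g21 := congrArg Prod.fst f2
  have g22 := congrArg Prod.snd f2
  simp only [Prod.smul_fst, Prod.smul_snd, smul_eq_mul] at g11 g12 g21 g22
  by_contra hc
  have hc' := hc
  unfold crossPl at hc'
  apply hw
  ext
  · refine (mul_eq_zero.mp (?_ : w.1 * crossPl (L w) (L w') = 0)).resolve_right hc
    unfold crossPl
    linear_combination (L w).2 * g11 - (L w).1 * g12
  · refine (mul_eq_zero.mp (?_ : w.2 * crossPl (L w) (L w') = 0)).resolve_right hc
    unfold crossPl
    linear_combination (L w).2 * g21 - (L w).1 * g22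

theorem aux_cross_inj (L : Pl →L[ℝ] Pl) (hL : Function.Injective L) (w w' : Pl) (hw : w ≠ 0)
    (h : crossPl (L w) (L w') = 0) : crossPl w w' = 0 := by
  have hu : L w ≠ 0 := fun h0 => hw (hL (by rw [h0, map_zero]))
  have e1 : (L w').1 • w = (L w).1 • w' := by
    apply hL
    rw [map_smul, map_smul]
    unfold crossPl at h
    ext <;> simp <;> linarith
  have e2 : (L w').2 • w = (L w).2 • w' := by
    apply hL
    rw [map_smul, map_smul]
    unfold crossPl at h
    ext <;> simp <;> linarith
  have g11 := congrArg Prod.fst e1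
  have g12 := congrArg Prod.snd e1
  have g21 := congrArg Prod.fst e2
  have g22 := congrArg Prod.snd e2
  simp only [Prod.smul_fst, Prod.smul_snd, smul_eq_mul] at g11 g12 g21 g22
  by_contra hc
  apply hu
  ext
  · refine (mul_eq_zero.mp (?_ : (L w).1 * crossPl w w' = 0)).resolve_right hc
    unfold crossPl
    linear_combination w.2 * g11 - w.1 * g12
  · refine (mul_eq_zero.mp (?_ : (L w).2 * crossPl w w' = 0)).resolve_right hc
    unfold crossPl
    linear_combination w.2 * g21 - w.1 * g22

/-- For a `C¹` diffeomorphism of the annulus isotopic to the identity,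
the total angular variations (`n·Torsionₙ`) computed at the same point with two nonzero
tangent vectors `w, w'` differ by less than `1/2` in absolute value. -/
theorem statement16 (S : IsotopySetup) (p : Pl) (n : ℕ) (hn : 1 ≤ n)
    (w w' : Pl) (hw : w ≠ 0) (hw' : w' ≠ 0)
    (a a' : ℝ) (ha : S.AngleVar p w n a) (ha' : S.AngleVar p w' n a') :
    -(1:ℝ)/2 < a - a' ∧ a - a' < 1/2 := by
  obtain ⟨Θ, hΘ, hD, rfl⟩ := ha
  obtain ⟨Θ', hΘ', hD', rfl⟩ := ha'
  have hN : (0:ℝ) ≤ n := Nat.cast_nonneg n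
  have key : ∀ t ∈ Icc (0:ℝ) n, (crossPl (S.D t p w) (S.D t p w') = 0 ↔
      ∃ k : ℤ, 2 * (Θ t - Θ' t) = k) := by
    intro t ht
    obtain ⟨r, hr, e⟩ := hD t ht
    obtain ⟨r', hr', e'⟩ := hD' t ht
    have hc : crossPl (S.D t p w) (S.D t p w') =
        -(r * r') * Real.sin (2 * (Θ t - Θ' t) * Real.pi) := by
      rw [e, e', show 2 * (Θ t - Θ' t) * Real.pi = 2 * Real.pi * Θ t - 2 * Real.pi * Θ' t by ring,
        Real.sin_sub]
      simp only [crossPl, Prod.smul_fst, Prod.smul_snd, smul_eq_mul]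
      ring
    have hrr : -(r * r') ≠ 0 := neg_ne_zero.mpr (mul_pos hr hr').ne'
    rw [hc, mul_eq_zero, or_iff_right hrr, Real.sin_eq_zero_iff]
    constructor
    · rintro ⟨k, hk⟩
      exact ⟨k, (mul_right_cancel₀ Real.pi_ne_zero hk).symm⟩
    · rintro ⟨k, hk⟩
      exact ⟨k, by rw [hk]⟩
  have hg : ContinuousOn (fun t => 2 * (Θ t - Θ' t)) (Icc 0 (n:ℝ)) :=
    continuousOn_const.mul (hΘ.sub hΘ')
  have main : -1 < 2 * (Θ n - Θ' n) - 2 * (Θ 0 - Θ' 0) ∧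
      2 * (Θ n - Θ' n) - 2 * (Θ 0 - Θ' 0) < 1 := by
    by_cases hc : crossPl w w' = 0
    · exact aux_integer _ _ hN hg fun t ht => (key t ht).1 (aux_cross _ _ _ hw hc)
    · exact aux_noninteger _ _ hN hg fun t ht k hk =>
        hc (aux_cross_inj _ (aux_D_inj S p t) _ _ hw ((key t ht).2 ⟨k, hk⟩))
  constructor <;> linarith [main.1, main.2]

end
end
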